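/- arXiv:2104.12019 — 4 statements merged into one kernel-verified Lean document; each statement's English description precedes it below -/
import Mathlib

section
/- Let I be a finite nonempty set of positive integers. Then for all complex numbers x and y, the double series Σ_{n ≥ 0} Σ_{k ≥ 0} P_n(C_I(σ) = k and C_{{1,…,n}∖I}(σ) = 0) · x^n y^k converges and equals exp( y · Σ_{m ∈ I} x^m / m ). (Here S_0 consists of the empty permutation, which has no cycles.) -/
open Finset

/-- The number of cycles of length `j` in the permutation `σ` of `{1,…,n}`
(fixed points count as cycles of length 1): the number of points whose
orbit under `σ` has size `j`, divided by `j`. -/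
noncomputable def cycleCount {n : ℕ} (σ : Equiv.Perm (Fin n)) (j : ℕ) : ℕ :=
  (Finset.univ.filter fun x => Function.minimalPeriod (⇑σ) x = j).card / j

/-- The number of cycles of `σ` whose length lies in the set `I`. -/
noncomputable def cycleCountIn {n : ℕ} (σ : Equiv.Perm (Fin n)) (I : Finset ℕ) : ℕ :=
  ∑ j ∈ I, cycleCount σ j

/-- The total number of cycles of `σ` (fixed points included as 1-cycles). -/
noncomputable def totalCycles {n : ℕ} (σ : Equiv.Perm (Fin n)) : ℕ :=
  cycleCountIn σ (Finset.Icc 1 n)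

/-- Probability of an event under a uniformly random permutation of `{1,…,n}`. -/
noncomputable def permP (n : ℕ) (E : Equiv.Perm (Fin n) → Prop) : ℝ :=
  (Nat.card {σ : Equiv.Perm (Fin n) // E σ} : ℝ) / n.factorial

/-- Expectation of `f` under a uniformly random permutation of `{1,…,n}`. -/
noncomputable def permE (n : ℕ) (f : Equiv.Perm (Fin n) → ℝ) : ℝ :=
  (∑ σ : Equiv.Perm (Fin n), f σ) / n.factorial

/-- `H(I) = ∑_{j ∈ I} 1/j`. -/
noncomputable def Hset (I : Finset ℕ) : ℝ := ∑ j ∈ I, (1 : ℝ) / j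

/-- The harmonic sum `H_n = ∑_{i=1}^n 1/i`. -/
noncomputable def harm (n : ℕ) : ℝ := Hset (Finset.Icc 1 n)


namespace Gruder
open Equiv Equiv.Perm

lemma minimalPeriod_eq {n : ℕ} (σ : Perm (Fin n)) (x : Fin n) (hx : σ x ≠ x) :
    Function.minimalPeriod (⇑σ) x = (σ.cycleOf x).support.card := by
  have hc := isCycle_cycleOf σ hx
  have hx' : σ.cycleOf x x ≠ x := by rwa [cycleOf_apply_self]
  have key : ∀ k, Function.IsPeriodicPt (⇑σ) k x ↔ (σ.cycleOf x).support.card ∣ k := by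
    intro k
    rw [← hc.orderOf, orderOf_dvd_iff_pow_eq_one, hc.pow_eq_one_iff' hx',
      cycleOf_pow_apply_self, Function.IsPeriodicPt, Function.IsFixedPt,
      Equiv.Perm.iterate_eq_pow]
  apply Nat.dvd_antisymm
  · exact Function.IsPeriodicPt.minimalPeriod_dvd ((key _).2 dvd_rfl)
  · exact (key _).1 (Function.isPeriodicPt_minimalPeriod _ _)

lemma card_filter {n : ℕ} (σ : Perm (Fin n)) (j : ℕ) (hj : 0 < j) :
    (Finset.univ.filter fun x => Function.minimalPeriod (⇑σ) x = j).card =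
      j * σ.partition.parts.count j := by
  rw [parts_partition, Multiset.count_add, Multiset.count_replicate]
  by_cases h1 : j = 1
  · subst h1
    have h0 : σ.cycleType.count 1 = 0 := by
      rw [Multiset.count_eq_zero]
      intro h
      exact absurd (one_lt_of_mem_cycleType h) (lt_irrefl _)
    rw [h0]
    have : (Finset.univ.filter fun x => Function.minimalPeriod (⇑σ) x = 1) = σ.supportᶜ := by
      ext x
      simp [Function.minimalPeriod_eq_one_iff_isFixedPt, Function.IsFixedPt]
    rw [this, Finset.card_compl]
    simp
  · rw [if_neg (Ne.symm h1), add_zero, cycleType_def, Multiset.count_map]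
    have : (Finset.univ.filter fun x => Function.minimalPeriod (⇑σ) x = j) =
        (σ.cycleFactorsFinset.filter fun c => j = c.support.card).biUnion support := by
      ext x
      simp only [Finset.mem_filter, Finset.mem_univ, true_and, Finset.mem_biUnion]
      constructor
      · intro h
        have hx : σ x ≠ x := by
          intro hx
          apply h1
          rw [← h]
          exact Function.minimalPeriod_eq_one_iff_isFixedPt.2 hx
        refine ⟨σ.cycleOf x, ⟨?_, ?_⟩, ?_⟩
        · rw [cycleOf_mem_cycleFactorsFinset_iff, mem_support]; exact hx
        · rw [← minimalPeriod_eq σ x hx, h]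
        · rw [mem_support, cycleOf_apply_self]; exact hx
      · rintro ⟨c, ⟨hc, hcj⟩, hxc⟩
        have hx : σ x ≠ x := mem_support.1 (mem_cycleFactorsFinset_support_le hc hxc)
        rw [minimalPeriod_eq σ x hx, ← cycle_is_cycleOf hxc hc, hcj]
    rw [this, Finset.card_biUnion]
    · rw [Finset.sum_congr rfl (g := fun _ => j)]
      · rw [Finset.sum_const, smul_eq_mul, mul_comm]
        rfl
      · intro c hc
        exact (Finset.mem_filter.1 hc).2.symm
    · intro c hc d hd hcd
      exact (cycleFactorsFinset_pairwise_disjoint σ (Finset.mem_filter.1 hc).1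
        (Finset.mem_filter.1 hd).1 hcd).disjoint_support

lemma cycleCount_eq {n : ℕ} (σ : Perm (Fin n)) (j : ℕ) (hj : 0 < j) :
    cycleCount σ j = σ.partition.parts.count j := by
  rw [cycleCount, card_filter σ j hj, Nat.mul_div_cancel_left _ hj]

lemma event_iff {n : ℕ} (σ : Perm (Fin n)) (I : Finset ℕ) (hpos : ∀ m ∈ I, 0 < m) (k : ℕ) :
    (cycleCountIn σ I = k ∧ cycleCountIn σ (Finset.Icc 1 n \ I) = 0) ↔
      σ.partition.parts.card = k ∧ ∀ m ∈ σ.partition.parts, m ∈ I := by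
  have e1 : cycleCountIn σ I = ∑ j ∈ I, σ.partition.parts.count j :=
    Finset.sum_congr rfl fun j hj => cycleCount_eq σ j (hpos j hj)
  have e2 : cycleCountIn σ (Finset.Icc 1 n \ I) = 0 ↔ ∀ m ∈ σ.partition.parts, m ∈ I := by
    rw [cycleCountIn, Finset.sum_eq_zero_iff]
    constructor
    · intro h m hm
      by_contra hmI
      have h1 : 0 < m := σ.partition.parts_pos hm
      have h2 : m ≤ n := by
        have := Multiset.le_sum_of_mem hm
        rwa [σ.partition.parts_sum, Fintype.card_fin] at this
      have := h m (by simp [hmI, h2]; omega)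
      rw [cycleCount_eq σ m h1, Multiset.count_eq_zero] at this
      exact this hm
    · intro h j hj
      simp only [Finset.mem_sdiff, Finset.mem_Icc] at hj
      rw [cycleCount_eq σ j (by omega), Multiset.count_eq_zero]
      exact fun hm => hj.2 (h j hm)
  rw [e1, e2]
  refine and_congr_left fun h => ?_
  rw [Multiset.sum_count_eq_card h]

/-- weight -/
def den (s : Multiset ℕ) : ℕ := s.prod * ∏ j ∈ s.toFinset, (s.count j).factorial

lemma den_pos (s : Multiset ℕ) (hs : ∀ m ∈ s, 0 < m) : 0 < den s :=
  Nat.mul_pos (Multiset.prod_pos hs) (Finset.prod_pos fun _ _ => Nat.factorial_pos _)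

lemma den_eq (s : Multiset ℕ) (hs : ∀ m ∈ s, 0 < m) (m : Multiset ℕ) (c : ℕ)
    (hm : ∀ a ∈ m, 2 ≤ a) (h : s = m + Multiset.replicate c 1) :
    den s = c.factorial * m.prod * ∏ j ∈ m.toFinset, (m.count j).factorial := by
  subst h
  have h1 : m.count 1 = 0 := by
    rw [Multiset.count_eq_zero]; intro h; have := hm 1 h; omega
  have : ∏ j ∈ (m + Multiset.replicate c 1).toFinset,
      ((m + Multiset.replicate c 1).count j).factorial =
      c.factorial * ∏ j ∈ m.toFinset, (m.count j).factorial := by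
    have hsub : (m + Multiset.replicate c 1).toFinset ⊆ insert 1 m.toFinset := by
      intro a ha
      simp only [Multiset.mem_toFinset, Multiset.mem_add, Multiset.mem_replicate] at ha
      simp only [Finset.mem_insert, Multiset.mem_toFinset]
      tauto
    rw [Finset.prod_subset hsub, Finset.prod_insert]
    · congr 1
      · rw [Multiset.count_add, h1, Multiset.count_replicate_self, zero_add]
      · refine Finset.prod_congr rfl fun j hj => ?_
        have := hm j (Multiset.mem_toFinset.1 hj)
        rw [Multiset.count_add, Multiset.count_replicate, if_neg (by omega), add_zero]
    · intro h; have := hm 1 (Multiset.mem_toFinset.1 h); omega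
    · intro a _ ha
      rw [Multiset.mem_toFinset, ← Multiset.count_eq_zero] at ha
      rw [ha, Nat.factorial_zero]
  rw [den, this, Multiset.prod_add, Multiset.prod_replicate, one_pow]
  ring

lemma card_parts (n : ℕ) (s : Multiset ℕ) (hs : ∀ m ∈ s, 0 < m) (hn : s.sum = n) :
    (Finset.univ.filter fun σ : Perm (Fin n) => σ.partition.parts = s).card * den s =
      n.factorial := by
  set m := s.filter (2 ≤ ·) with hm
  have hm2 : ∀ a ∈ m, 2 ≤ a := fun a ha => (Multiset.mem_filter.1 ha).2
  have hsm : s = m + Multiset.replicate (n - m.sum) 1 := by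
    have h1 := Multiset.filter_add_not (2 ≤ ·) s
    have h2 : s.filter (fun a => ¬ 2 ≤ a) =
        Multiset.replicate (s.filter (fun a => ¬ 2 ≤ a)).card 1 := by
      rw [Multiset.eq_replicate_card]
      intro b hb
      rw [Multiset.mem_filter] at hb
      have := hs b hb.1
      omega
    have h3 := congrArg Multiset.sum h1
    rw [h2] at h3 h1
    rw [Multiset.sum_add, Multiset.sum_replicate, hn, ← hm, smul_eq_mul, mul_one] at h3
    have h4 : n - m.sum = (s.filter (fun a => ¬ 2 ≤ a)).card := by omega
    rw [h4, hm, h1]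
  have hle : m.sum ≤ n := by
    rw [← hn]
    conv_rhs => rw [hsm, Multiset.sum_add]
    omega
  have hf : (Finset.univ.filter fun σ : Perm (Fin n) => σ.partition.parts = s) =
      Finset.univ.filter fun σ : Perm (Fin n) => σ.cycleType = m := by
    ext σ
    simp only [Finset.mem_filter, Finset.mem_univ, true_and]
    constructor
    · intro h
      rw [← filter_parts_partition_eq_cycleType, h]
    · intro h
      rw [parts_partition, ← sum_cycleType, h, Fintype.card_fin]
      exact hsm.symm
  have := card_of_cycleType_mul_eq (Fin n) m
  rw [if_pos ⟨by simpa using hle, hm2⟩, Fintype.card_fin] at this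
  rw [hf, den_eq s hs m _ hm2 hsm, this]

lemma permP_eq (I : Finset ℕ) (hpos : ∀ m ∈ I, 0 < m) (n k : ℕ) :
    permP n (fun σ => cycleCountIn σ I = k ∧ cycleCountIn σ (Finset.Icc 1 n \ I) = 0) =
      ∑ s ∈ I.sym k, if s.1.sum = n then (den s.1 : ℝ)⁻¹ else 0 := by
  have hc : Nat.card {σ : Perm (Fin n) // cycleCountIn σ I = k ∧
      cycleCountIn σ (Finset.Icc 1 n \ I) = 0} =
      ∑ s ∈ I.sym k, (Finset.univ.filter fun σ : Perm (Fin n) =>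
        σ.partition.parts = s.1).card := by
    rw [← Finset.card_biUnion]
    · classical
      rw [Nat.card_eq_fintype_card, Fintype.card_subtype]
      congr 1
      ext σ
      simp only [Finset.mem_filter, Finset.mem_univ, true_and, Finset.mem_biUnion,
        event_iff σ I hpos k]
      constructor
      · rintro ⟨h1, h2⟩
        exact ⟨⟨σ.partition.parts, h1⟩, Finset.mem_sym_iff.2 h2, rfl⟩
      · rintro ⟨s, hs, h⟩
        rw [h]
        exact ⟨s.2, Finset.mem_sym_iff.1 hs⟩
    · intro s _ t _ hst
      refine Finset.disjoint_left.2 fun σ h1 h2 => hst ?_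
      simp only [Finset.mem_filter, Finset.mem_univ, true_and] at h1 h2
      exact Subtype.ext (h1.symm.trans h2)
  rw [permP, hc, Nat.cast_sum, Finset.sum_div]
  refine Finset.sum_congr rfl fun s hs => ?_
  have hs' : ∀ m ∈ s.1, 0 < m := fun m hm => hpos m (Finset.mem_sym_iff.1 hs m hm)
  split_ifs with h
  · have h1 := card_parts n s.1 hs' h
    have h2 : (den s.1 : ℝ) ≠ 0 := by exact_mod_cast (den_pos s.1 hs').ne'
    rw [← h1]
    rw [Nat.cast_mul]
    have h3 : ((Finset.univ.filter fun σ : Perm (Fin n) =>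
        σ.partition.parts = s.1).card : ℝ) ≠ 0 := by
      intro h0
      rw [Nat.cast_eq_zero] at h0
      rw [h0, zero_mul] at h1
      exact (Nat.factorial_ne_zero n) h1.symm
    field_simp
  · rw [Finset.filter_false_of_mem, Finset.card_empty, Nat.cast_zero, zero_div]
    intro σ _ hσ
    apply h
    rw [← hσ, σ.partition.parts_sum, Fintype.card_fin]

lemma countPerms_mul (s : Multiset ℕ) :
    (∏ j ∈ s.toFinset, (s.count j).factorial) * s.countPerms = s.card.factorial := by
  have := Nat.multinomial_spec s.toFinset (fun j => s.count j)
  rw [Multiset.toFinset_sum_count_eq] at this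
  rw [← this]
  rfl

lemma prod_map_pow_sum (x : ℂ) (s : Multiset ℕ) :
    (s.map fun m : ℕ => x ^ m).prod = x ^ s.sum := by
  induction s using Multiset.induction with
  | empty => simp
  | cons a s ih => simp [ih, pow_add]

lemma pow_eq (I : Finset ℕ) (hpos : ∀ m ∈ I, 0 < m) (k : ℕ) (x : ℂ) :
    (∑ m ∈ I, x ^ m / (m : ℂ)) ^ k / k.factorial =
      ∑ s ∈ I.sym k, x ^ s.1.sum * (den s.1 : ℂ)⁻¹ := by
  rw [Finset.sum_pow, Finset.sum_div]
  refine Finset.sum_congr rfl fun s hs => ?_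
  have hs' : ∀ m ∈ s.1, 0 < m := fun m hm => hpos m (Finset.mem_sym_iff.1 hs m hm)
  have h1 : ((s.1 : Multiset ℕ).map fun m : ℕ => x ^ m / (m : ℂ)).prod = x ^ s.1.sum / (s.1.prod : ℂ) := by
    rw [Multiset.prod_map_div]
    congr 1
    · exact prod_map_pow_sum x s.1
    · rw [Nat.cast_multiset_prod]
  have h2 := countPerms_mul s.1
  have h3 : s.1.card = k := s.2
  rw [h3] at h2
  have h4 : (den s.1 : ℂ) ≠ 0 := by exact_mod_cast (den_pos s.1 hs').ne'
  have h5 : (k.factorial : ℂ) ≠ 0 := by exact_mod_cast k.factorial_ne_zero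
  rw [← h2] at h5 ⊢
  change _ * ((s.1 : Multiset ℕ).map fun m : ℕ => x ^ m / (m : ℂ)).prod / _ = _
  rw [h1]
  rw [den] at h4 ⊢
  push_cast at h4 h5 ⊢
  have h6 := mul_ne_zero_iff.1 h4
  have h7 := mul_ne_zero_iff.1 h5
  have h8 := h6.1
  have h9 := h6.2
  have h10 := h7.2
  field_simp

lemma hasSum_n (I : Finset ℕ) (hpos : ∀ m ∈ I, 0 < m) (k : ℕ) (x y : ℂ) :
    HasSum (fun n => ((permP n (fun σ => cycleCountIn σ I = k ∧
            cycleCountIn σ (Finset.Icc 1 n \ I) = 0) : ℝ) : ℂ) * x ^ n * y ^ k)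
      ((y * ∑ m ∈ I, x ^ m / (m : ℂ)) ^ k / k.factorial) := by
  rw [mul_pow, mul_div_assoc, pow_eq I hpos, mul_comm]
  refine HasSum.mul_right _ ?_
  simp_rw [permP_eq I hpos]
  push_cast
  simp_rw [Finset.sum_mul]
  refine hasSum_sum fun s _ => ?_
  have h0 := hasSum_ite_eq s.1.sum (x ^ s.1.sum * (den s.1 : ℂ)⁻¹)
  refine (congrArg (fun g : ℕ → ℂ => HasSum g (x ^ s.1.sum * (den s.1 : ℂ)⁻¹)) ?_).mp h0
  funext n
  symm
  by_cases h : s.1.sum = n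
  · subst h; simp [mul_comm]
  · rw [if_neg h, if_neg (Ne.symm h)]; simp

lemma permP_nonneg (n : ℕ) (E : Perm (Fin n) → Prop) : 0 ≤ permP n E := by
  unfold permP; positivity

end Gruder

/-- **Gruder's generating function** for a finite set `I` of positive integers:
for all complex `x, y`, the double series
`Σ_{n,k} P_n(C_I(σ) = k ∧ C_{[n]∖I}(σ) = 0) xⁿ yᵏ` converges to
`exp(y Σ_{m ∈ I} xᵐ/m)`. -/
theorem gruder_generating_function (I : Finset ℕ) (hI : I.Nonempty)
    (hpos : ∀ m ∈ I, 0 < m) (x y : ℂ) :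
    HasSum
      (fun p : ℕ × ℕ =>
        ((permP p.1 (fun σ => cycleCountIn σ I = p.2 ∧
            cycleCountIn σ (Finset.Icc 1 p.1 \ I) = 0) : ℝ) : ℂ) * x ^ p.1 * y ^ p.2)
      (Complex.exp (y * ∑ m ∈ I, x ^ m / (m : ℂ))) := by
  rw [← (Equiv.prodComm ℕ ℕ).hasSum_iff]
  set f : ℕ × ℕ → ℂ := (fun p : ℕ × ℕ =>
        ((permP p.1 (fun σ => cycleCountIn σ I = p.2 ∧
            cycleCountIn σ (Finset.Icc 1 p.1 \ I) = 0) : ℝ) : ℂ) * x ^ p.1 * y ^ p.2) ∘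
            (Equiv.prodComm ℕ ℕ) with hf
  have hexp : ∀ z : ℂ, HasSum (fun k : ℕ => z ^ k / (k.factorial : ℂ)) (Complex.exp z) := by
    intro z
    rw [Complex.exp_eq_exp_ℂ]
    exact NormedSpace.expSeries_div_hasSum_exp z
  have hfib : ∀ k, HasSum (fun n => f (k, n))
      ((y * ∑ m ∈ I, x ^ m / (m : ℂ)) ^ k / k.factorial) :=
    fun k => Gruder.hasSum_n I hpos k x y
  have hnorm : ∀ k, HasSum (fun n => ((‖f (k, n)‖ : ℝ) : ℂ))
      ((((‖y‖ : ℝ) : ℂ) * ∑ m ∈ I, ((‖x‖ : ℝ) : ℂ) ^ m / (m : ℂ)) ^ k / k.factorial) := by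
    intro k
    convert Gruder.hasSum_n I hpos k ((‖x‖ : ℝ) : ℂ) ((‖y‖ : ℝ) : ℂ) using 2 with n
    simp only [hf, Function.comp, Equiv.prodComm_apply, Prod.swap, norm_mul, norm_pow,
      Complex.norm_real, Real.norm_of_nonneg (Gruder.permP_nonneg _ _)]
    push_cast
    rfl
  have hsum : Summable f := by
    apply Summable.of_norm
    rw [summable_prod_of_nonneg (fun _ => norm_nonneg _)]
    refine ⟨fun k => Complex.summable_ofReal.1 (hnorm k).summable, ?_⟩
    rw [← Complex.summable_ofReal]
    refine (hexp (((‖y‖ : ℝ) : ℂ) * ∑ m ∈ I, ((‖x‖ : ℝ) : ℂ) ^ m / (m : ℂ))).summable.congr ?_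
    intro k
    rw [Complex.ofReal_tsum, (hnorm k).tsum_eq]
  have h := hsum.hasSum.prod_fiberwise hfib
  rw [← h.unique (hexp _)]
  exact hsum.hasSum
end

section
/- Let I_1, I_2, …, I_k be pairwise disjoint nonempty subsets of {1,…,n} and let m_1, …, m_k be nonnegative integers. Then E[ ∏_{j=1}^k binom(C_{I_j}(σ), m_j) ] ≤ ∏_{j=1}^k H(I_j)^{m_j} / m_j!, with equality if and only if Σ_{j=1}^k m_j · max(I_j) ≤ n. -/
open Finset

open Equiv.Perm in
lemma minPeriod_eq {n : ℕ} (σ : Equiv.Perm (Fin n)) (x : Fin n) (hx : σ x ≠ x) :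
    Function.minimalPeriod (⇑σ) x = (σ.cycleOf x).support.card := by
  have hc := isCycleOn_support_cycleOf σ x
  have hmem : x ∈ (σ.cycleOf x).support := by
    rw [mem_support_cycleOf_iff' hx]
  apply Nat.dvd_antisymm
  · apply Function.IsPeriodicPt.minimalPeriod_dvd
    have := (hc.pow_apply_eq hmem (n := (σ.cycleOf x).support.card)).2 dvd_rfl
    rwa [Equiv.Perm.coe_pow] at this
  · rw [← hc.pow_apply_eq hmem, Equiv.Perm.coe_pow]
    exact Function.isPeriodicPt_minimalPeriod _ _

open Equiv.Perm in
lemma cycleCount_eq {n : ℕ} (σ : Equiv.Perm (Fin n)) (j : ℕ) (hj : 1 ≤ j) :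
    cycleCount σ j = σ.partition.parts.count j := by
  have key : (Finset.univ.filter fun x => Function.minimalPeriod (⇑σ) x = j).card
      = j * σ.partition.parts.count j := by
    rw [parts_partition, Multiset.count_add]
    rcases eq_or_lt_of_le hj with rfl | hj2
    · have h1 : σ.cycleType.count 1 = 0 := by
        rw [Multiset.count_eq_zero]
        intro h
        have := one_lt_of_mem_cycleType h
        omega
      rw [h1, Multiset.count_replicate_self, one_mul, zero_add, ← Finset.card_compl]
      congr 1
      ext x
      simp [Function.minimalPeriod_eq_one_iff_isFixedPt, Function.IsFixedPt]
    · rw [Multiset.count_replicate, if_neg (by omega), add_zero, cycleType_def, Multiset.count_map]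
      have hset : (Finset.univ.filter fun x => Function.minimalPeriod (⇑σ) x = j)
          = (σ.cycleFactorsFinset.filter fun c => j = c.support.card).biUnion
              (fun c => c.support) := by
        ext x
        simp only [Finset.mem_filter, Finset.mem_univ, true_and, Finset.mem_biUnion]
        constructor
        · intro h
          have hx : σ x ≠ x := by
            intro hx
            have : Function.minimalPeriod (⇑σ) x = 1 :=
              Function.minimalPeriod_eq_one_iff_isFixedPt.2 hx
            omega
          refine ⟨σ.cycleOf x, ⟨?_, ?_⟩, ?_⟩
          · rw [cycleOf_mem_cycleFactorsFinset_iff]; simpa using hx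
          · rw [← h, minPeriod_eq σ x hx]
          · rw [mem_support_cycleOf_iff' hx]
        · rintro ⟨c, ⟨hc, hcj⟩, hxc⟩
          have h1 := cycle_is_cycleOf hxc hc
          have hx : σ x ≠ x := by
            have := mem_cycleFactorsFinset_support_le hc hxc
            simpa using this
          rw [minPeriod_eq σ x hx, ← h1, hcj]
      rw [hset, Finset.card_biUnion]
      · rw [Finset.sum_congr rfl (g := fun _ => j)]
        · rw [Finset.sum_const, smul_eq_mul, mul_comm]
          rfl
        · intro c hc
          exact (Finset.mem_filter.1 hc).2.symm
      · intro c hc d hd hcd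
        have := cycleFactorsFinset_pairwise_disjoint σ (Finset.mem_filter.1 hc).1
          (Finset.mem_filter.1 hd).1 hcd
        exact this.disjoint_support
  rw [cycleCount, key, Nat.mul_div_cancel_left _ (by omega)]

/-- The weight of a multiset of cycle lengths. -/
noncomputable def wt (J : Finset ℕ) (s : Multiset ℕ) : ℝ :=
  ∏ j ∈ J, (1 / (j : ℝ)) ^ s.count j / (s.count j).factorial

lemma card_partition {n : ℕ} (J : Finset ℕ) (h1 : 1 ∈ J) (hJ : Finset.Icc 1 n ⊆ J)
    (p : Nat.Partition n) :
    ((Finset.univ.filter fun σ : Equiv.Perm (Fin n) => σ.partition.parts = p.parts).card : ℝ)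
      = n.factorial * wt J p.parts := by
  set m := p.parts.filter (fun i => 2 ≤ i) with hm
  have hparts : p.parts = m + Multiset.replicate (p.parts.count 1) 1 := by
    conv_lhs => rw [← Multiset.filter_add_not (fun i => 2 ≤ i) p.parts]
    congr 1
    rw [← Multiset.filter_eq' p.parts 1]
    apply Multiset.filter_congr
    intro x hx
    have := p.parts_pos hx
    omega
  have hsum : m.sum + p.parts.count 1 = n := by
    have h := congrArg Multiset.sum hparts
    rw [p.parts_sum, Multiset.sum_add, Multiset.sum_replicate] at h
    simpa using h.symm
  have hset : (Finset.univ.filter fun σ : Equiv.Perm (Fin n) => σ.partition.parts = p.parts)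
      = Finset.univ.filter fun σ : Equiv.Perm (Fin n) => σ.cycleType = m := by
    ext σ
    simp only [Finset.mem_filter, Finset.mem_univ, true_and]
    constructor
    · intro h
      rw [← Equiv.Perm.filter_parts_partition_eq_cycleType, h]
    · intro h
      rw [Equiv.Perm.parts_partition, ← Equiv.Perm.sum_cycleType, h, hparts, Fintype.card_fin]
      congr 2
      omega
  have hcard := Equiv.Perm.card_of_cycleType_mul_eq (Fin n) m
  rw [if_pos ⟨by rw [Fintype.card_fin]; omega, fun a ha => (Multiset.mem_filter.1 ha).2⟩,
    Fintype.card_fin] at hcard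
  have hsub : m.toFinset ⊆ J.erase 1 := by
    intro x hx
    rw [Multiset.mem_toFinset] at hx
    have h2 := (Multiset.mem_filter.1 hx)
    have h3 : x ≤ n := p.parts_sum ▸ Multiset.le_sum_of_mem h2.1
    exact Finset.mem_erase.2 ⟨by have := h2.2; omega, hJ (Finset.mem_Icc.2 ⟨by have := h2.2; omega, h3⟩)⟩
  have hprod : ((n - m.sum).factorial * m.prod * (∏ i ∈ m.toFinset, (m.count i).factorial))
      = ∏ j ∈ J, (j ^ p.parts.count j * (p.parts.count j).factorial) := by
    rw [← Finset.mul_prod_erase J _ h1, one_pow, one_mul, mul_assoc]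
    congr 1
    · congr 1; omega
    · rw [Finset.prod_multiset_count, ← Finset.prod_mul_distrib]
      rw [Finset.prod_subset hsub]
      · apply Finset.prod_congr rfl
        intro x hx
        have hx1 := (Finset.mem_erase.1 hx).1
        have : p.parts.count x = m.count x := by
          rw [hparts, Multiset.count_add, Multiset.count_replicate, if_neg (by omega), add_zero]
        rw [this]
      · intro x _ hx
        rw [Multiset.mem_toFinset] at hx
        rw [Multiset.count_eq_zero.2 hx]; simp
  rw [hprod, ← hset] at hcard
  rw [← hcard, wt]
  push_cast
  rw [mul_assoc, ← Finset.prod_mul_distrib]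
  rw [Finset.prod_eq_one, mul_one]
  intro j hj
  by_cases h0 : j = 0
  · subst h0
    have : p.parts.count 0 = 0 := by
      rw [Multiset.count_eq_zero]
      intro h
      exact absurd (p.parts_pos h) (by simp)
    simp [this]
  · have : (j : ℝ) ≠ 0 := by exact_mod_cast h0
    have h2 : ((p.parts.count j).factorial : ℝ) ≠ 0 := by positivity
    rw [one_div, inv_pow]
    field_simp

lemma sum_perm {n : ℕ} (J : Finset ℕ) (h1 : 1 ∈ J) (hJ : Finset.Icc 1 n ⊆ J)
    (f : Multiset ℕ → ℝ) :
    ∑ σ : Equiv.Perm (Fin n), f σ.partition.parts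
      = n.factorial * ∑ p : Nat.Partition n, wt J p.parts * f p.parts := by
  let g : Equiv.Perm (Fin n) → Nat.Partition n := fun σ =>
    ⟨σ.partition.parts, fun h => σ.partition.parts_pos h, by
      rw [σ.partition.parts_sum, Fintype.card_fin]⟩
  rw [← Finset.sum_fiberwise (s := Finset.univ) (g := g), Finset.mul_sum]
  apply Finset.sum_congr rfl
  intro p _
  rw [← mul_assoc, ← card_partition J h1 hJ p]
  rw [Finset.sum_congr rfl (g := fun _ => f p.parts)]
  · rw [Finset.sum_const, nsmul_eq_mul]
    congr 3
    ext σ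
    simp [g, Nat.Partition.ext_iff]
  · intro σ hσ
    rw [← (Finset.mem_filter.1 hσ).2]

lemma sum_wt {n : ℕ} (J : Finset ℕ) (h1 : 1 ∈ J) (hJ : Finset.Icc 1 n ⊆ J) :
    ∑ p : Nat.Partition n, wt J p.parts = 1 := by
  have h := sum_perm J h1 hJ (fun _ => 1)
  simp only [Finset.sum_const, mul_one, Finset.card_univ, Fintype.card_perm, Fintype.card_fin,
    nsmul_eq_mul] at h
  have h2 : (n.factorial : ℝ) ≠ 0 := by positivity
  field_simp at h
  linarith

lemma key_sum {n : ℕ} (J : Finset ℕ) (h1 : 1 ∈ J) (h0 : 0 ∉ J) (hJ : Finset.Icc 1 n ⊆ J)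
    (a : Multiset ℕ) (ha : ∀ x ∈ a, x ∈ J) :
    ∑ p : Nat.Partition n, wt J p.parts * ∏ j ∈ J, ((p.parts.count j).choose (a.count j) : ℝ)
      = if a.sum ≤ n then wt J a else 0 := by
  have hz : ∀ p : Nat.Partition n, ¬ a ≤ p.parts →
      wt J p.parts * ∏ j ∈ J, ((p.parts.count j).choose (a.count j) : ℝ) = 0 := by
    intro p hp
    rw [Multiset.le_iff_count] at hp
    push Not at hp
    obtain ⟨x, hx⟩ := hp
    have hxa : x ∈ a := by
      rw [← Multiset.count_pos]; omega
    rw [Finset.prod_eq_zero (ha x hxa), mul_zero]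
    rw [Nat.choose_eq_zero_of_lt hx, Nat.cast_zero]
  split_ifs with hs
  · rw [← Finset.sum_filter_of_ne (p := fun p : Nat.Partition n => a ≤ p.parts)
      (fun p _ h => by by_contra h'; exact h (hz p h'))]
    rw [← mul_one (wt J a), ← sum_wt (n := n - a.sum) J h1
      (fun x hx => hJ (by rw [Finset.mem_Icc] at *; omega)), Finset.mul_sum]
    refine Finset.sum_bij' (fun p hp => (⟨p.parts - a, fun {i} hi => p.parts_pos
        (Multiset.mem_of_le (Multiset.sub_le_self _ _) hi), ?_⟩ : Nat.Partition (n - a.sum)))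
      (fun q _ => (⟨q.parts + a, fun {i} hi => ?_, ?_⟩ : Nat.Partition n)) ?_ ?_ ?_ ?_ ?_
    · have h := (Finset.mem_filter.1 hp).2
      have h2 : (p.parts - a).sum + a.sum = n := by
        rw [← Multiset.sum_add, Multiset.sub_add_cancel h, p.parts_sum]
      omega
    · rcases Multiset.mem_add.1 hi with hi | hi
      · exact q.parts_pos hi
      · exact Nat.pos_of_ne_zero (fun h => h0 (h ▸ ha i hi))
    · rw [Multiset.sum_add, q.parts_sum]; omega
    · intros; exact Finset.mem_univ _
    · intro q _
      simp
    · intro p hp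
      have h := (Finset.mem_filter.1 hp).2
      ext1
      exact Multiset.sub_add_cancel h
    · intro q _
      ext1
      simp
    · intro p hp
      have h := (Finset.mem_filter.1 hp).2
      simp only [wt]
      rw [← Finset.prod_mul_distrib, ← Finset.prod_mul_distrib]
      apply Finset.prod_congr rfl
      intro j _
      have hle := Multiset.le_iff_count.1 h j
      rw [Multiset.count_sub, Nat.cast_choose ℝ hle]
      have h2 : ((p.parts.count j).factorial : ℝ) ≠ 0 := by positivity
      have : (1 / (j : ℝ)) ^ p.parts.count j
        = (1 / (j : ℝ)) ^ a.count j * (1 / (j : ℝ)) ^ (p.parts.count j - a.count j) := by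
        rw [← pow_add]; congr 1; omega
      rw [this]
      field_simp
  · apply Finset.sum_eq_zero
    intro p _
    apply hz
    intro h
    apply hs
    obtain ⟨b, hb⟩ := Multiset.le_iff_exists_add.1 h
    have := congrArg Multiset.sum hb
    rw [p.parts_sum, Multiset.sum_add] at this
    omega

lemma wt_pos (J : Finset ℕ) (h0 : 0 ∉ J) (a : Multiset ℕ) : 0 < wt J a := by
  apply Finset.prod_pos
  intro j hj
  have : 0 < j := Nat.pos_of_ne_zero (fun h => h0 (h ▸ hj))
  positivity

/-- Combined multiset of cycle lengths. -/
def tot {k : ℕ} (I : Fin k → Finset ℕ) (b : Fin k → ℕ → ℕ) : Multiset ℕ :=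
  ∑ j, ∑ i ∈ I j, Multiset.replicate (b j i) i

lemma count_tot {k : ℕ} (I : Fin k → Finset ℕ) (b : Fin k → ℕ → ℕ) (x : ℕ) :
    (tot I b).count x = ∑ j, if x ∈ I j then b j x else 0 := by
  simp only [tot, Multiset.count_sum', Multiset.count_replicate]
  simp

lemma sum_tot {k : ℕ} (I : Fin k → Finset ℕ) (b : Fin k → ℕ → ℕ) :
    (tot I b).sum = ∑ j, ∑ i ∈ I j, b j i * i := by
  simp [tot, Multiset.sum_sum]

lemma prod_tot {k : ℕ} (I : Fin k → Finset ℕ) (b : Fin k → ℕ → ℕ)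
    (hdisj : ∀ i j, i ≠ j → Disjoint (I i) (I j)) (J : Finset ℕ) (hJ : ∀ j, I j ⊆ J)
    (f : ℕ → ℕ → ℝ) (hf : ∀ x, f x 0 = 1) :
    ∏ x ∈ J, f x ((tot I b).count x) = ∏ j, ∏ x ∈ I j, f x (b j x) := by
  have hsub : Finset.univ.biUnion I ⊆ J := by
    intro x hx
    obtain ⟨j, _, hj⟩ := Finset.mem_biUnion.1 hx
    exact hJ j hj
  rw [← Finset.prod_subset hsub, Finset.prod_biUnion]
  · apply Finset.prod_congr rfl
    intro j _
    apply Finset.prod_congr rfl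
    intro x hx
    rw [count_tot, Finset.sum_eq_single j]
    · rw [if_pos hx]
    · intro i _ hij
      rw [if_neg]
      intro h
      exact Finset.disjoint_left.1 (hdisj i j hij) h hx
    · simp
  · intro i _ j _ hij
    exact hdisj i j hij
  · intro x _ hx
    rw [count_tot, Finset.sum_eq_zero, hf]
    intro j _
    rw [if_neg]
    intro h
    exact hx (Finset.mem_biUnion.2 ⟨j, Finset.mem_univ _, h⟩)

lemma multi_vandermonde (s : Finset ℕ) (c : ℕ → ℕ) (m : ℕ) :
    (∑ i ∈ s, c i).choose m
      = ∑ b ∈ s.piAntidiag m, ∏ i ∈ s, (c i).choose (b i) := by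
  have h := PowerSeries.coeff_prod
    (fun i => (((1 + Polynomial.X) ^ c i : Polynomial ℕ) : PowerSeries ℕ)) m s
  have h2 : ∏ i ∈ s, (((1 + Polynomial.X) ^ c i : Polynomial ℕ) : PowerSeries ℕ)
      = (((1 + Polynomial.X) ^ (∑ i ∈ s, c i) : Polynomial ℕ) : PowerSeries ℕ) := by
    simp only [Polynomial.coe_pow]
    rw [Finset.prod_pow_eq_pow_sum]
  rw [h2] at h
  simp only [Polynomial.coeff_coe, Polynomial.coeff_one_add_X_pow, Nat.cast_id] at h
  rw [h, Finset.finsuppAntidiag, Finset.sum_map]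
  exact Finset.sum_attach (s.piAntidiag m) (fun b => ∏ i ∈ s, (c i).choose (b i))

lemma multi_exp (s : Finset ℕ) (c : ℕ → ℝ) (m : ℕ) :
    (∑ i ∈ s, c i) ^ m / m.factorial
      = ∑ b ∈ s.piAntidiag m, ∏ i ∈ s, c i ^ b i / (b i).factorial := by
  rw [Finset.sum_pow_eq_sum_piAntidiag, Finset.sum_div]
  apply Finset.sum_congr rfl
  intro b hb
  have hb := (Finset.mem_piAntidiag.1 hb).1
  rw [Finset.prod_div_distrib]
  have h := Nat.multinomial_spec s b
  rw [hb] at h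
  rw [← h]
  push_cast
  have : (∏ i ∈ s, ((b i).factorial : ℝ)) ≠ 0 := by
    apply Finset.prod_ne_zero_iff.2; intros; positivity
  have : (Nat.multinomial s b : ℝ) ≠ 0 := by
    have := Nat.multinomial_pos s b
    positivity
  field_simp

/-- **Binomial moments of cycle counts.** For disjoint nonempty sets
`I₁,…,I_k ⊆ [n]` and nonnegative integers `m₁,…,m_k`,
`E ∏ binom(C_{I_j}(σ), m_j) ≤ ∏ H(I_j)^{m_j}/m_j!`, with equality iff
`Σ m_j · max(I_j) ≤ n`. -/
theorem binomial_moments_cycle_counts (n k : ℕ) (I : Fin k → Finset ℕ)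
    (hne : ∀ j, (I j).Nonempty) (hsub : ∀ j, I j ⊆ Finset.Icc 1 n)
    (hdisj : ∀ i j, i ≠ j → Disjoint (I i) (I j)) (m : Fin k → ℕ) :
    permE n (fun σ => ∏ j, ((cycleCountIn σ (I j)).choose (m j) : ℝ))
      ≤ ∏ j, Hset (I j) ^ m j / (m j).factorial ∧
    (permE n (fun σ => ∏ j, ((cycleCountIn σ (I j)).choose (m j) : ℝ))
        = ∏ j, Hset (I j) ^ m j / (m j).factorial ↔
      ∑ j, m j * (I j).max' (hne j) ≤ n) := by
  set J : Finset ℕ := Finset.Icc 1 (n + 1) with hJdef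
  have h1 : 1 ∈ J := by simp [J]
  have h0 : 0 ∉ J := by simp [J]
  have hJ : Finset.Icc 1 n ⊆ J := Finset.Icc_subset_Icc_right (by omega)
  have hIJ : ∀ j, I j ⊆ J := fun j => (hsub j).trans hJ
  set B : Finset (Fin k → ℕ → ℕ) := Fintype.piFinset (fun j => (I j).piAntidiag (m j)) with hB
  have hRHS : ∏ j, Hset (I j) ^ m j / (m j).factorial = ∑ b ∈ B, wt J (tot I b) := by
    simp only [Hset, multi_exp]
    rw [Finset.prod_univ_sum]
    apply Finset.sum_congr rfl
    intro b _
    rw [wt, prod_tot I b hdisj J hIJ (fun x c => (1 / (x : ℝ)) ^ c / c.factorial) (by simp)]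
  have hLHS : permE n (fun σ => ∏ j, ((cycleCountIn σ (I j)).choose (m j) : ℝ))
      = ∑ b ∈ B, if (tot I b).sum ≤ n then wt J (tot I b) else 0 := by
    have e1 : ∀ σ : Equiv.Perm (Fin n), ∏ j, ((cycleCountIn σ (I j)).choose (m j) : ℝ)
        = (fun s : Multiset ℕ => ∏ j, ((∑ i ∈ I j, s.count i).choose (m j) : ℝ))
            σ.partition.parts := by
      intro σ
      apply Finset.prod_congr rfl
      intro j _
      congr 2
      apply Finset.sum_congr rfl
      intro i hi
      exact cycleCount_eq σ i (Finset.mem_Icc.1 (hsub j hi)).1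
    unfold permE
    rw [Finset.sum_congr rfl (fun σ _ => e1 σ), sum_perm J h1 hJ
      (fun s : Multiset ℕ => ∏ j, ((∑ i ∈ I j, s.count i).choose (m j) : ℝ)), mul_div_cancel_left₀ _ (by positivity)]
    have e2 : ∀ p : Nat.Partition n,
        wt J p.parts * ∏ j, ((∑ i ∈ I j, p.parts.count i).choose (m j) : ℝ)
        = ∑ b ∈ B, wt J p.parts
            * ∏ x ∈ J, ((p.parts.count x).choose ((tot I b).count x) : ℝ) := by
      intro p
      rw [← Finset.mul_sum]
      congr 1
      simp only [multi_vandermonde]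
      push_cast
      rw [Finset.prod_univ_sum]
      apply Finset.sum_congr rfl
      intro b _
      rw [prod_tot I b hdisj J hIJ (fun x c => ((p.parts.count x).choose c : ℝ)) (by simp)]
    rw [Finset.sum_congr rfl (fun p _ => e2 p), Finset.sum_comm]
    apply Finset.sum_congr rfl
    intro b _
    apply key_sum J h1 h0 hJ
    intro x hx
    by_contra hxJ
    rw [← Multiset.count_pos, count_tot, Finset.sum_eq_zero] at hx
    · omega
    · intro j _
      rw [if_neg (fun h => hxJ (hIJ j h))]
  have hle : ∀ b ∈ B, (if (tot I b).sum ≤ n then wt J (tot I b) else 0) ≤ wt J (tot I b) := by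
    intro b _
    split_ifs
    · exact le_rfl
    · exact (wt_pos J h0 _).le
  rw [hLHS, hRHS]
  refine ⟨Finset.sum_le_sum hle, ?_⟩
  rw [Finset.sum_eq_sum_iff_of_le hle]
  constructor
  · intro h
    have hmem : (fun j => Pi.single ((I j).max' (hne j)) (m j) : Fin k → ℕ → ℕ) ∈ B := by
      rw [hB, Fintype.mem_piFinset]
      intro j
      rw [Finset.mem_piAntidiag]
      have hmax := (I j).max'_mem (hne j)
      constructor
      · rw [Finset.sum_pi_single', if_pos hmax]
      · intro i hi
        by_contra hi'
        apply hi
        rw [Pi.single_eq_of_ne]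
        rintro rfl
        exact hi' hmax
    have h2 := h _ hmem
    have h3 : (tot I (fun j => Pi.single ((I j).max' (hne j)) (m j) : Fin k → ℕ → ℕ)).sum ≤ n := by
      by_contra h4
      rw [if_neg h4] at h2
      exact (wt_pos J h0 _).ne h2
    rw [sum_tot] at h3
    refine le_of_eq_of_le ?_ h3
    apply Finset.sum_congr rfl
    intro j _
    rw [Finset.sum_eq_single ((I j).max' (hne j))]
    · simp
    · intro i _ hi
      rw [Pi.single_eq_of_ne hi, zero_mul]
    · intro h5
      exact absurd ((I j).max'_mem (hne j)) h5
  · intro h b hb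
    rw [if_pos]
    rw [sum_tot]
    refine le_trans (Finset.sum_le_sum fun j _ => ?_) h
    have hbj := (Finset.mem_piAntidiag.1 (Fintype.mem_piFinset.1 hb j)).1
    rw [← hbj, Finset.sum_mul]
    exact Finset.sum_le_sum fun i hi => Nat.mul_le_mul_left _ ((I j).le_max' i hi)
end

section
/- Let I_1, …, I_r be pairwise disjoint nonempty subsets of {1,…,n} and let m_1, …, m_r be nonnegative integers. Set ε = 0 if I_1 ∪ ⋯ ∪ I_r = {1,…,n} and ε = 1 otherwise. Then P( C_{I_1}(σ) = m_1, …, C_{I_r}(σ) = m_r ) ≤ (e^{H_n} / n) · ∏_{j=1}^r ( H(I_j)^{m_j} / m_j! · e^{−H(I_j)} ) · ( ε + m_1/H(I_1) + ⋯ + m_r/H(I_r) ). -/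
open Finset

open Equiv.Perm in
lemma minPer_eq {n : ℕ} (σ : Equiv.Perm (Fin n)) (x : Fin n) (hx : x ∈ σ.support) :
    Function.minimalPeriod (⇑σ) x = (σ.cycleOf x).support.card := by
  have hx' : σ x ≠ x := Equiv.Perm.mem_support.1 hx
  have hc := Equiv.Perm.isCycle_cycleOf σ hx'
  rw [← hc.orderOf]
  have key : ∀ k, Function.IsPeriodicPt (⇑σ) k x ↔ (σ.cycleOf x) ^ k = 1 := by
    intro k
    rw [hc.pow_eq_one_iff' (x := x) (by simpa using hx'), cycleOf_pow_apply_self]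
    simp [Function.IsPeriodicPt, Function.IsFixedPt, ← Equiv.Perm.iterate_eq_pow]
  apply Nat.dvd_antisymm
  · exact ((key _).2 (pow_orderOf_eq_one _)).minimalPeriod_dvd
  · exact orderOf_dvd_of_pow_eq_one ((key _).1 (Function.isPeriodicPt_minimalPeriod _ _))

open Equiv.Perm in
lemma card_filter_minPer {n : ℕ} (σ : Equiv.Perm (Fin n)) (j : ℕ) (hj : 2 ≤ j) :
    (Finset.univ.filter fun x => Function.minimalPeriod (⇑σ) x = j).card =
      σ.cycleType.count j * j := by
  classical
  have h1 : (Finset.univ.filter fun x => Function.minimalPeriod (⇑σ) x = j) =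
      (σ.cycleFactorsFinset.filter fun f => f.support.card = j).biUnion (fun f => f.support) := by
    ext x
    simp only [Finset.mem_filter, Finset.mem_univ, true_and, Finset.mem_biUnion]
    constructor
    · intro h
      have hx : x ∈ σ.support := by
        rw [Equiv.Perm.mem_support]
        intro hfix
        have : Function.minimalPeriod (⇑σ) x = 1 :=
          Function.minimalPeriod_eq_one_iff_isFixedPt.2 hfix
        omega
      refine ⟨σ.cycleOf x, ⟨cycleOf_mem_cycleFactorsFinset_iff.2 hx, ?_⟩, ?_⟩
      · rw [← minPer_eq σ x hx, h]
      · exact mem_support_cycleOf_iff.2 ⟨SameCycle.refl _ _, hx⟩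
    · rintro ⟨f, ⟨hf, hfj⟩, hx⟩
      have hxs := mem_cycleFactorsFinset_support_le hf hx
      rw [minPer_eq σ x hxs, ← cycle_is_cycleOf hx hf, hfj]
  rw [h1, Finset.card_biUnion]
  · rw [Finset.sum_congr rfl (fun f hf => (Finset.mem_filter.1 hf).2), Finset.sum_const,
      smul_eq_mul, cycleType_def, Multiset.count_map]
    congr 1
    rw [Finset.card_def, Finset.filter_val]
    congr 1
    apply Multiset.filter_congr
    intro f _
    simp [eq_comm]
  · intro f hf g hg hfg
    exact (cycleFactorsFinset_pairwise_disjoint σ (Finset.mem_filter.1 hf).1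
      (Finset.mem_filter.1 hg).1 hfg).disjoint_support

lemma cycleCount_of_two_le {n : ℕ} (σ : Equiv.Perm (Fin n)) (j : ℕ) (hj : 2 ≤ j) :
    cycleCount σ j = σ.cycleType.count j := by
  rw [cycleCount, card_filter_minPer σ j hj, Nat.mul_div_cancel _ (by omega)]

lemma cycleCount_mul {n : ℕ} (σ : Equiv.Perm (Fin n)) (j : ℕ) (hj : 1 ≤ j) :
    j * cycleCount σ j =
      (Finset.univ.filter fun x => Function.minimalPeriod (⇑σ) x = j).card := by
  rcases Nat.lt_or_ge j 2 with h | h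
  · obtain rfl : j = 1 := by omega
    simp [cycleCount]
  · rw [cycleCount_of_two_le σ j h, card_filter_minPer σ j h, mul_comm]

lemma cycleCount_one {n : ℕ} (σ : Equiv.Perm (Fin n)) :
    cycleCount σ 1 = n - σ.cycleType.sum := by
  have := Equiv.Perm.card_fixedPoints σ
  rw [Fintype.card_fin] at this
  rw [← this, cycleCount, Nat.div_one, Fintype.card_subtype]
  congr 1
  ext x
  simp [Function.minimalPeriod_eq_one_iff_isFixedPt, Function.mem_fixedPoints]

lemma minPer_mem {n : ℕ} (σ : Equiv.Perm (Fin n)) (x : Fin n) :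
    Function.minimalPeriod (⇑σ) x ∈ Finset.Icc 1 n := by
  rw [Finset.mem_Icc]
  by_cases hx : x ∈ σ.support
  · rw [minPer_eq σ x hx]
    refine ⟨?_, ?_⟩
    · apply Finset.card_pos.2
      exact ⟨x, Equiv.Perm.mem_support_cycleOf_iff.2 ⟨Equiv.Perm.SameCycle.refl _ _, hx⟩⟩
    · simpa using Finset.card_le_univ (σ.cycleOf x).support
  · rw [Function.minimalPeriod_eq_one_iff_isFixedPt.2 (Equiv.Perm.notMem_support.1 hx)]
    exact ⟨le_rfl, x.pos⟩

lemma cycleCount_supp {n : ℕ} (σ : Equiv.Perm (Fin n)) (j : ℕ) (hj : cycleCount σ j ≠ 0) :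
    j ∈ Finset.Icc 1 n := by
  by_contra h
  apply hj
  rw [cycleCount, Finset.card_eq_zero.2, Nat.zero_div]
  rw [Finset.filter_eq_empty_iff]
  intro x _ hx
  exact h (hx ▸ minPer_mem σ x)

lemma sum_mul_cycleCount {n : ℕ} (σ : Equiv.Perm (Fin n)) :
    ∑ j ∈ Finset.Icc 1 n, j * cycleCount σ j = n := by
  rw [Finset.sum_congr rfl (fun j hj => cycleCount_mul σ j (Finset.mem_Icc.1 hj).1)]
  rw [← Finset.card_eq_sum_card_fiberwise (fun x _ => minPer_mem σ x)]
  simp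

/-- Poisson-type weight. -/
noncomputable def gw (S : Finset ℕ) (c : ℕ → ℕ) : ℝ :=
  ∏ j ∈ S, ((1 : ℝ) / j) ^ c j / (c j).factorial

lemma gw_nonneg (S : Finset ℕ) (c : ℕ → ℕ) : 0 ≤ gw S c := by
  unfold gw; positivity

open scoped Classical in
lemma card_cycleCount_eq {n : ℕ} (hn : 1 ≤ n) (c : ℕ → ℕ) :
    ((Finset.univ.filter fun σ : Equiv.Perm (Fin n) => cycleCount σ = c).card : ℝ) ≤
      n.factorial * gw (Finset.Icc 1 n) c := by
  classical
  by_cases hex : ∃ σ : Equiv.Perm (Fin n), cycleCount σ = c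
  · obtain ⟨σ, rfl⟩ := hex
    set μ := σ.cycleType with hμ
    have h1 : (Finset.univ.filter fun τ : Equiv.Perm (Fin n) => cycleCount τ = cycleCount σ) ⊆
        Finset.univ.filter fun τ : Equiv.Perm (Fin n) => τ.cycleType = μ := by
      intro τ hτ
      simp only [Finset.mem_filter, Finset.mem_univ, true_and] at hτ ⊢
      ext j
      rcases Nat.lt_or_ge j 2 with h | h
      · rw [Multiset.count_eq_zero_of_notMem, Multiset.count_eq_zero_of_notMem]
        · intro h'; have := Equiv.Perm.two_le_of_mem_cycleType h'; omega
        · intro h'; have := Equiv.Perm.two_le_of_mem_cycleType h'; omega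
      · rw [← cycleCount_of_two_le τ j h, ← cycleCount_of_two_le σ j h, hτ]
    have h2 := Equiv.Perm.card_of_cycleType_mul_eq (Fin n) μ
    rw [if_pos ⟨by simpa using Equiv.Perm.sum_cycleType_le σ,
      fun a ha => Equiv.Perm.two_le_of_mem_cycleType ha⟩, Fintype.card_fin] at h2
    have hsub : μ.toFinset ⊆ Finset.Icc 2 n := by
      intro j hj
      rw [Multiset.mem_toFinset] at hj
      rw [Finset.mem_Icc]
      refine ⟨Equiv.Perm.two_le_of_mem_cycleType hj, ?_⟩
      have : cycleCount σ j ≠ 0 := by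
        rw [cycleCount_of_two_le σ j (Equiv.Perm.two_le_of_mem_cycleType hj)]
        exact (Multiset.count_pos.2 hj).ne'
      exact (Finset.mem_Icc.1 (cycleCount_supp σ j this)).2
    have h3 : μ.prod = ∏ j ∈ Finset.Icc 2 n, j ^ cycleCount σ j := by
      rw [Finset.prod_multiset_count_of_subset μ _ hsub]
      exact Finset.prod_congr rfl fun j hj => by
        rw [cycleCount_of_two_le σ j (Finset.mem_Icc.1 hj).1]
    have h4 : (∏ j ∈ μ.toFinset, (μ.count j).factorial) =
        ∏ j ∈ Finset.Icc 2 n, (cycleCount σ j).factorial := by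
      rw [Finset.prod_subset hsub]
      · exact Finset.prod_congr rfl fun j hj => by
          rw [cycleCount_of_two_le σ j (Finset.mem_Icc.1 hj).1]
      · intro j _ hj
        rw [Multiset.count_eq_zero_of_notMem (by simpa using hj), Nat.factorial_zero]
    rw [h3, h4, ← cycleCount_one σ] at h2
    have hI : Finset.Icc 1 n = insert 1 (Finset.Icc 2 n) := by
      ext j; simp only [Finset.mem_Icc, Finset.mem_insert]; omega
    have hD : (((cycleCount σ 1).factorial * (∏ j ∈ Finset.Icc 2 n, j ^ cycleCount σ j) *
        ∏ j ∈ Finset.Icc 2 n, (cycleCount σ j).factorial : ℕ) : ℝ) *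
        gw (Finset.Icc 1 n) (cycleCount σ) = 1 := by
      rw [gw, hI, Finset.prod_insert (by simp)]
      push_cast
      rw [Finset.prod_div_distrib]
      simp only [div_pow, one_pow, div_one, Finset.prod_div_distrib,
        Finset.prod_const_one]
      have a1 : (∏ j ∈ Finset.Icc 2 n, (j : ℝ) ^ cycleCount σ j) ≠ 0 := by
        apply Finset.prod_ne_zero_iff.2
        intro j hj
        have := (Finset.mem_Icc.1 hj).1
        have : (j : ℝ) ≠ 0 := by norm_cast; omega
        positivity
      have a2 : (∏ j ∈ Finset.Icc 2 n, ((cycleCount σ j).factorial : ℝ)) ≠ 0 := by positivity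
      have a3 : ((cycleCount σ 1).factorial : ℝ) ≠ 0 := by positivity
      field_simp
    calc _ ≤ ((Finset.univ.filter fun τ : Equiv.Perm (Fin n) => τ.cycleType = μ).card : ℝ) := by
          exact_mod_cast Finset.card_le_card h1
      _ = _ := by
          rw [← h2, Nat.cast_mul, mul_assoc, hD, mul_one]
  · rw [Finset.filter_false_of_mem]
    · simpa using mul_nonneg (by positivity) (gw_nonneg _ _)
    · intro σ _ h; exact hex ⟨σ, h⟩

lemma sum_gw_piAntidiag (S : Finset ℕ) (M : ℕ) :
    ∑ k ∈ Finset.piAntidiag S M, gw S k = Hset S ^ M / M.factorial := by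
  rw [Hset, Finset.sum_pow_eq_sum_piAntidiag, Finset.sum_div]
  refine Finset.sum_congr rfl fun k hk => ?_
  have hs := (Finset.mem_piAntidiag.1 hk).1
  have h := Nat.multinomial_spec S k
  rw [hs] at h
  rw [gw, Finset.prod_div_distrib, ← h]
  push_cast
  have a2 : (∏ j ∈ S, ((k j).factorial : ℝ)) ≠ 0 := by positivity
  have a3 : ((Nat.multinomial S k : ℕ) : ℝ) ≠ 0 := by
    have := Nat.multinomial_pos S k
    positivity
  field_simp

lemma Hset_nonneg (S : Finset ℕ) : 0 ≤ Hset S := by unfold Hset; positivity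

lemma sum_gw_le_exp (S : Finset ℕ) (t : Finset (ℕ → ℕ))
    (ht : ∀ c ∈ t, ∀ j, c j ≠ 0 → j ∈ S) : ∑ c ∈ t, gw S c ≤ Real.exp (Hset S) := by
  classical
  set N := t.sup (fun c => ∑ j ∈ S, c j) + 1
  have hsub : t ⊆ (Finset.range N).biUnion (fun M => Finset.piAntidiag S M) := by
    intro c hc
    rw [Finset.mem_biUnion]
    refine ⟨∑ j ∈ S, c j, ?_, Finset.mem_piAntidiag.2 ⟨rfl, ht c hc⟩⟩
    rw [Finset.mem_range]
    exact Nat.lt_succ_of_le (Finset.le_sup (f := fun c : ℕ → ℕ => ∑ j ∈ S, c j) hc)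
  calc _ ≤ ∑ c ∈ (Finset.range N).biUnion (fun M => Finset.piAntidiag S M), gw S c :=
        Finset.sum_le_sum_of_subset_of_nonneg hsub fun _ _ _ => gw_nonneg _ _
    _ = ∑ M ∈ Finset.range N, Hset S ^ M / M.factorial := by
        rw [Finset.sum_biUnion]
        · exact Finset.sum_congr rfl fun M _ => sum_gw_piAntidiag S M
        · intro a _ b _ hab
          rw [Function.onFun, Finset.disjoint_left]
          intro c hc hc'
          exact hab ((Finset.mem_piAntidiag.1 hc).1.symm.trans (Finset.mem_piAntidiag.1 hc').1)
    _ ≤ _ := Real.sum_le_exp_of_nonneg (Hset_nonneg S) N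

/-- restriction of a function to a set -/
def restr (S : Finset ℕ) (c : ℕ → ℕ) : ℕ → ℕ := fun l => if l ∈ S then c l else 0

lemma gw_restr (S : Finset ℕ) (c : ℕ → ℕ) : gw S (restr S c) = gw S c := by
  unfold gw restr
  exact Finset.prod_congr rfl fun j hj => by simp [hj]

lemma classes_bound (n r : ℕ) (I : Fin r → Finset ℕ)
    (hsub : ∀ j, I j ⊆ Finset.Icc 1 n)
    (hdisj : ∀ i j, i ≠ j → Disjoint (I i) (I j)) (m : Fin r → ℕ)
    (T : Finset (ℕ → ℕ)) (hT : ∀ c ∈ T, ∀ j, c j ≠ 0 → j ∈ Finset.Icc 1 n)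
    (hTm : ∀ c ∈ T, ∀ i, ∑ j ∈ I i, c j = m i) :
    ∑ c ∈ T, gw (Finset.Icc 1 n) c ≤
      Real.exp (harm n) * ∏ j, Hset (I j) ^ m j / (m j).factorial * Real.exp (-Hset (I j)) := by
  classical
  set U := Finset.univ.biUnion I with hU
  set J0 := Finset.Icc 1 n \ U with hJ0
  have hUsub : U ⊆ Finset.Icc 1 n := Finset.biUnion_subset.2 fun i _ => hsub i
  have hpd : Set.PairwiseDisjoint (↑(Finset.univ : Finset (Fin r))) I :=
    fun i _ j _ hij => hdisj i j hij
  -- exponent bookkeeping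
  have hH : harm n = Hset J0 + ∑ i, Hset (I i) := by
    rw [harm, Hset, ← Finset.sum_sdiff hUsub, Finset.sum_biUnion hpd]
    rfl
  have hg : ∀ c, gw (Finset.Icc 1 n) c = gw J0 c * ∏ i, gw (I i) c := by
    intro c
    rw [gw, ← Finset.prod_sdiff hUsub, Finset.prod_biUnion hpd]
    rfl
  have hR : Real.exp (harm n) * ∏ j, Hset (I j) ^ m j / (m j).factorial * Real.exp (-Hset (I j))
      = Real.exp (Hset J0) * ∏ j, Hset (I j) ^ m j / (m j).factorial := by
    rw [Finset.prod_mul_distrib, ← Real.exp_sum, mul_comm (∏ j, _), ← mul_assoc, ← Real.exp_add,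
      hH, Finset.sum_neg_distrib, add_neg_cancel_right]
  rw [hR]
  set t0 := T.image (restr J0) with ht0
  have h0 : ∑ k ∈ t0, gw J0 k ≤ Real.exp (Hset J0) := by
    apply sum_gw_le_exp
    intro c hc j hj
    obtain ⟨d, _, rfl⟩ := Finset.mem_image.1 hc
    by_contra h
    exact hj (by simp [restr, h])
  have h1 : ∏ j, Hset (I j) ^ m j / (m j).factorial =
      ∑ p ∈ Fintype.piFinset (fun i => Finset.piAntidiag (I i) (m i)), ∏ i, gw (I i) (p i) := by
    rw [← Finset.prod_univ_sum]
    exact Finset.prod_congr rfl fun i _ => (sum_gw_piAntidiag _ _).symm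
  have hprod : 0 ≤ ∏ j, Hset (I j) ^ m j / ((m j).factorial : ℝ) :=
    Finset.prod_nonneg fun j _ => div_nonneg (pow_nonneg (Hset_nonneg _) _) (by positivity)
  refine le_trans ?_ (mul_le_mul_of_nonneg_right h0 hprod)
  rw [h1, Finset.sum_mul_sum, ← Finset.sum_product']
  let φ : (ℕ → ℕ) → (ℕ → ℕ) × (Fin r → ℕ → ℕ) := fun c => (restr J0 c, fun i => restr (I i) c)
  have hinj : Set.InjOn φ T := by
    intro c hc d hd h
    simp only [φ, Prod.mk.injEq] at h
    funext l
    by_cases hl : l ∈ Finset.Icc 1 n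
    · by_cases hlu : l ∈ U
      · obtain ⟨i, _, hi⟩ := Finset.mem_biUnion.1 hlu
        have := congrFun (congrFun h.2 i) l
        simpa [restr, hi] using this
      · have hl0 : l ∈ J0 := Finset.mem_sdiff.2 ⟨hl, hlu⟩
        have := congrFun h.1 l
        simpa only [restr, hl0, if_true] using this
    · have a := fun h' => hl (hT c hc l h')
      have b := fun h' => hl (hT d hd l h')
      rw [not_not.1 a, not_not.1 b]
  have himg : T.image φ ⊆ t0 ×ˢ Fintype.piFinset (fun i => Finset.piAntidiag (I i) (m i)) := by
    intro p hp
    obtain ⟨c, hc, rfl⟩ := Finset.mem_image.1 hp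
    rw [Finset.mem_product]
    refine ⟨Finset.mem_image_of_mem _ hc, ?_⟩
    rw [Fintype.mem_piFinset]
    intro i
    rw [Finset.mem_piAntidiag]
    refine ⟨?_, ?_⟩
    · rw [← hTm c hc i]
      exact Finset.sum_congr rfl fun j hj => by simp [φ, restr, hj]
    · intro j hj
      by_contra h
      exact hj (by simp [φ, restr, h])
  calc ∑ c ∈ T, gw (Finset.Icc 1 n) c
      = ∑ p ∈ T.image φ, gw J0 p.1 * ∏ i, gw (I i) (p.2 i) := by
        rw [Finset.sum_image hinj]
        refine Finset.sum_congr rfl fun c _ => ?_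
        simp only [φ, gw_restr, hg]
    _ ≤ _ := Finset.sum_le_sum_of_subset_of_nonneg himg fun p _ _ =>
        mul_nonneg (gw_nonneg _ _) (Finset.prod_nonneg fun i _ => gw_nonneg _ _)

/-- lower the count at `j` by one -/
def dec (c : ℕ → ℕ) (j : ℕ) : ℕ → ℕ := Function.update c j (c j - 1)

lemma gw_dec (S : Finset ℕ) (c : ℕ → ℕ) (j : ℕ) (hj : j ∈ S) (hj1 : 1 ≤ j) (hc : c j ≠ 0) :
    (j : ℝ) * c j * gw S c = gw S (dec c j) := by
  obtain ⟨a, ha⟩ := Nat.exists_eq_succ_of_ne_zero hc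
  have hj0 : (j : ℝ) ≠ 0 := by norm_cast; omega
  rw [gw, gw, ← Finset.mul_prod_erase S _ hj, ← Finset.mul_prod_erase S _ hj, ← mul_assoc]
  congr 1
  · simp only [dec, Function.update_self, ha, Nat.succ_eq_add_one, Nat.add_sub_cancel,
      Nat.factorial_succ]
    push_cast
    have : ((a.factorial : ℕ) : ℝ) ≠ 0 := by positivity
    have : (a : ℝ) + 1 ≠ 0 := by positivity
    rw [one_div, inv_pow, inv_pow]
    field_simp
    ring
  · refine Finset.prod_congr rfl fun l hl => ?_
    rw [dec, Function.update_of_ne (Finset.ne_of_mem_erase hl)]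

lemma sum_dec (S : Finset ℕ) (f c : ℕ → ℕ) (j : ℕ) (hj : j ∈ S) (hc : c j ≠ 0) :
    ∑ l ∈ S, f l * dec c j l + f j = ∑ l ∈ S, f l * c l := by
  rw [← Finset.add_sum_erase S _ hj, ← Finset.add_sum_erase S _ hj]
  have : ∑ l ∈ S.erase j, f l * dec c j l = ∑ l ∈ S.erase j, f l * c l :=
    Finset.sum_congr rfl fun l hl => by
      rw [dec, Function.update_of_ne (Finset.ne_of_mem_erase hl)]
  rw [this, dec, Function.update_self]
  obtain ⟨a, ha⟩ := Nat.exists_eq_succ_of_ne_zero hc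
  rw [ha]; simp only [Nat.succ_eq_add_one, Nat.add_sub_cancel]; ring

lemma dec_of_notMem (S : Finset ℕ) (c : ℕ → ℕ) (j : ℕ) (hj : j ∉ S) :
    ∑ l ∈ S, dec c j l = ∑ l ∈ S, c l :=
  Finset.sum_congr rfl fun l hl => by
    have hne : l ≠ j := by rintro rfl; exact hj hl
    rw [dec, Function.update_of_ne hne]

/-- One class of removed cycle lengths. -/
lemma remove_bound (n r : ℕ) (I : Fin r → Finset ℕ)
    (hsub : ∀ j, I j ⊆ Finset.Icc 1 n)
    (hdisj : ∀ i j, i ≠ j → Disjoint (I i) (I j)) (m' : Fin r → ℕ)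
    (T : Finset (ℕ → ℕ)) (hT : ∀ c ∈ T, ∀ j, c j ≠ 0 → j ∈ Finset.Icc 1 n)
    (hTn : ∀ c ∈ T, ∑ j ∈ Finset.Icc 1 n, j * c j = n)
    (K : Finset ℕ) (hK : K ⊆ Finset.Icc 1 n)
    (hm : ∀ c ∈ T, ∀ j ∈ K, c j ≠ 0 → ∀ i, ∑ l ∈ I i, dec c j l = m' i) :
    ∑ c ∈ T, ∑ j ∈ K, (j : ℝ) * c j * gw (Finset.Icc 1 n) c ≤
      Real.exp (harm n) * ∏ j, Hset (I j) ^ m' j / (m' j).factorial * Real.exp (-Hset (I j)) := by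
  classical
  rw [← Finset.sum_product']
  set Q := (T ×ˢ K).filter (fun p => p.1 p.2 ≠ 0) with hQ
  have hQm : ∀ p ∈ Q, p.1 ∈ T ∧ p.2 ∈ K ∧ p.1 p.2 ≠ 0 := by
    intro p hp
    rw [hQ, Finset.mem_filter, Finset.mem_product] at hp
    exact ⟨hp.1.1, hp.1.2, hp.2⟩
  have h1 : ∑ p ∈ T ×ˢ K, (p.2 : ℝ) * p.1 p.2 * gw (Finset.Icc 1 n) p.1 =
      ∑ p ∈ Q, gw (Finset.Icc 1 n) (dec p.1 p.2) := by
    have : ∑ p ∈ T ×ˢ K, (p.2 : ℝ) * p.1 p.2 * gw (Finset.Icc 1 n) p.1 =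
        ∑ p ∈ Q, (p.2 : ℝ) * p.1 p.2 * gw (Finset.Icc 1 n) p.1 := by
      symm
      apply Finset.sum_subset (Finset.filter_subset _ _)
      intro p hp hp'
      have : p.1 p.2 = 0 := by
        by_contra h
        exact hp' (Finset.mem_filter.2 ⟨hp, h⟩)
      simp [this]
    rw [this]
    refine Finset.sum_congr rfl fun p hp => ?_
    obtain ⟨_, hk, h0⟩ := hQm p hp
    exact gw_dec _ _ _ (hK hk) (Finset.mem_Icc.1 (hK hk)).1 h0
  have hinj : Set.InjOn (fun p : (ℕ → ℕ) × ℕ => dec p.1 p.2) Q := by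
    rintro ⟨c, j⟩ hp ⟨d, k⟩ hq h
    obtain ⟨hc, hj, hc0⟩ := hQm _ hp
    obtain ⟨hd, hk, hd0⟩ := hQm _ hq
    simp only at h hc hj hc0 hd hk hd0
    have e1 := sum_dec (Finset.Icc 1 n) (fun l => l) c j (hK hj) hc0
    have e2 := sum_dec (Finset.Icc 1 n) (fun l => l) d k (hK hk) hd0
    rw [hTn c hc] at e1
    rw [hTn d hd, ← h] at e2
    obtain rfl : j = k := by omega
    congr 1
    funext l
    have := congrFun h l
    by_cases hl : l = j
    · subst hl
      simp only [dec, Function.update_self] at this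
      omega
    · simpa only [dec, Function.update_of_ne hl] using this
  have hdef : ∑ c ∈ T ×ˢ K, (c.2 : ℝ) * c.1 c.2 * gw (Finset.Icc 1 n) c.1 =
      ∑ d ∈ Q.image (fun p => dec p.1 p.2), gw (Finset.Icc 1 n) d := by
    rw [h1, Finset.sum_image hinj]
  rw [hdef]
  apply classes_bound n r I hsub hdisj m'
  · intro d hd j hj
    obtain ⟨⟨c, k⟩, hp, rfl⟩ := Finset.mem_image.1 hd
    obtain ⟨hc, hk, hc0⟩ := hQm _ hp
    apply hT c hc
    intro h
    apply hj
    by_cases hl : j = k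
    · subst hl; exact absurd h hc0
    · simpa only [dec, Function.update_of_ne hl] using h
  · intro d hd i
    obtain ⟨⟨c, k⟩, hp, rfl⟩ := Finset.mem_image.1 hd
    obtain ⟨hc, hk, hc0⟩ := hQm _ hp
    exact hm c hc k hk hc0 i

theorem joint_local_upper_bound (n r : ℕ) (hn : 1 ≤ n) (I : Fin r → Finset ℕ)
    (hne : ∀ j, (I j).Nonempty) (hsub : ∀ j, I j ⊆ Finset.Icc 1 n)
    (hdisj : ∀ i j, i ≠ j → Disjoint (I i) (I j)) (m : Fin r → ℕ) :
    permP n (fun σ => ∀ j, cycleCountIn σ (I j) = m j)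
      ≤ Real.exp (harm n) / n *
          (∏ j, Hset (I j) ^ m j / (m j).factorial * Real.exp (-Hset (I j))) *
          ((if Finset.univ.biUnion I = Finset.Icc 1 n then (0 : ℝ) else 1) +
            ∑ j, (m j : ℝ) / Hset (I j)) := by
  classical
  set E := Finset.univ.filter
    (fun σ : Equiv.Perm (Fin n) => ∀ j, cycleCountIn σ (I j) = m j) with hE
  set T := E.image (fun σ => cycleCount σ) with hTdef
  set G := Finset.Icc 1 n with hG
  set P := ∏ j, Hset (I j) ^ m j / (m j).factorial * Real.exp (-Hset (I j)) with hP
  have hn0 : (0 : ℝ) < n := by exact_mod_cast hn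
  have hTex : ∀ c ∈ T, ∃ σ : Equiv.Perm (Fin n),
      (∀ j, cycleCountIn σ (I j) = m j) ∧ cycleCount σ = c := by
    intro c hc
    obtain ⟨σ, hσ, h⟩ := Finset.mem_image.1 hc
    exact ⟨σ, (Finset.mem_filter.1 hσ).2, h⟩
  have hT : ∀ c ∈ T, ∀ j, c j ≠ 0 → j ∈ Finset.Icc 1 n := by
    intro c hc j hj
    obtain ⟨σ, _, rfl⟩ := hTex c hc
    exact cycleCount_supp σ j hj
  have hTn : ∀ c ∈ T, ∑ j ∈ Finset.Icc 1 n, j * c j = n := by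
    intro c hc
    obtain ⟨σ, _, rfl⟩ := hTex c hc
    exact sum_mul_cycleCount σ
  have hTm : ∀ c ∈ T, ∀ i, ∑ j ∈ I i, c j = m i := by
    intro c hc i
    obtain ⟨σ, h, rfl⟩ := hTex c hc
    exact h i
  have hperm : permP n (fun σ => ∀ j, cycleCountIn σ (I j) = m j) ≤ ∑ c ∈ T, gw G c := by
    have hf : (0 : ℝ) < n.factorial := by positivity
    rw [permP, div_le_iff₀ hf]
    have hcard : Nat.card {σ : Equiv.Perm (Fin n) // ∀ j, cycleCountIn σ (I j) = m j}
        = E.card := by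
      rw [Nat.card_eq_fintype_card, Fintype.card_subtype]
    rw [hcard, Finset.card_eq_sum_card_image (fun σ => cycleCount σ) E, Nat.cast_sum,
      Finset.sum_mul]
    refine Finset.sum_le_sum fun c _ => ?_
    rw [mul_comm]
    refine le_trans ?_ (card_cycleCount_eq hn c)
    norm_cast
    apply Finset.card_le_card
    intro σ hσ
    exact Finset.mem_filter.2 ⟨Finset.mem_univ _, (Finset.mem_filter.1 hσ).2⟩
  have hHpos : ∀ i, 0 < Hset (I i) := by
    intro i
    apply Finset.sum_pos _ (hne i)
    intro j hj
    have := (Finset.mem_Icc.1 (hsub i hj)).1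
    have : (0 : ℝ) < j := by exact_mod_cast this
    positivity
  set U := Finset.univ.biUnion I with hU
  have hUsub : U ⊆ G := Finset.biUnion_subset.2 fun i _ => hsub i
  have hpd : Set.PairwiseDisjoint (↑(Finset.univ : Finset (Fin r))) I :=
    fun i _ j _ hij => hdisj i j hij
  -- the classes
  have hcls : ∀ i, ∑ c ∈ T, ∑ j ∈ I i, (j : ℝ) * c j * gw G c ≤
      Real.exp (harm n) * P * (m i / Hset (I i)) := by
    intro i
    rcases Nat.eq_zero_or_pos (m i) with h0 | hpos
    · rw [h0]
      simp only [Nat.cast_zero, zero_div, mul_zero]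
      apply le_of_eq
      refine Finset.sum_eq_zero fun c hc => Finset.sum_eq_zero fun j hj => ?_
      have := hTm c hc i
      rw [h0, Finset.sum_eq_zero_iff] at this
      simp [this j hj]
    · refine (remove_bound n r I hsub hdisj (Function.update m i (m i - 1)) T hT hTn (I i)
        (hsub i) ?_).trans (le_of_eq ?_)
      · intro c hc j hj hcj i'
        by_cases hi : i' = i
        · subst hi
          have := sum_dec (I i') (fun _ => 1) c j hj hcj
          simp only [one_mul, hTm c hc i'] at this
          rw [Function.update_self]
          omega
        · rw [Function.update_of_ne hi, dec_of_notMem, hTm c hc i']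
          exact Finset.disjoint_left.1 (hdisj i i' (Ne.symm hi)) hj
      · rw [mul_assoc]
        congr 1
        rw [hP, ← Finset.mul_prod_erase _ _ (Finset.mem_univ i),
          ← Finset.mul_prod_erase _ _ (Finset.mem_univ i),
          mul_right_comm _ _ ((m i : ℝ) / Hset (I i))]
        congr 1
        · rw [Function.update_self]
          obtain ⟨a, ha⟩ := Nat.exists_eq_succ_of_ne_zero hpos.ne'
          rw [ha]
          simp only [Nat.succ_eq_add_one, Nat.add_sub_cancel, Nat.factorial_succ]
          have h1 := (hHpos i).ne'
          have h2 : ((a.factorial : ℕ) : ℝ) ≠ 0 := by positivity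
          have h3 : (a : ℝ) + 1 ≠ 0 := by positivity
          push_cast
          field_simp
          ring
        · refine Finset.prod_congr rfl fun l hl => ?_
          rw [Function.update_of_ne (Finset.ne_of_mem_erase hl)]
  have hrest : ∑ c ∈ T, ∑ j ∈ G \ U, (j : ℝ) * c j * gw G c ≤
      Real.exp (harm n) * P * (if U = G then (0 : ℝ) else 1) := by
    split_ifs with h
    · simp [h]
    · rw [mul_one]
      refine remove_bound n r I hsub hdisj m T hT hTn (G \ U) Finset.sdiff_subset ?_
      intro c hc j hj hcj i
      rw [dec_of_notMem, hTm c hc i]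
      intro h'
      exact (Finset.mem_sdiff.1 hj).2 (Finset.mem_biUnion.2 ⟨i, Finset.mem_univ _, h'⟩)
  have hmain : n * ∑ c ∈ T, gw G c ≤ Real.exp (harm n) * P *
      ((if U = G then (0 : ℝ) else 1) + ∑ j, (m j : ℝ) / Hset (I j)) := by
    have e : n * ∑ c ∈ T, gw G c = ∑ c ∈ T, ∑ j ∈ G \ U, (j : ℝ) * c j * gw G c +
        ∑ i, ∑ c ∈ T, ∑ j ∈ I i, (j : ℝ) * c j * gw G c := by
      rw [Finset.sum_comm (s := Finset.univ), ← Finset.sum_add_distrib, Finset.mul_sum]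
      refine Finset.sum_congr rfl fun c hc => ?_
      rw [← Finset.sum_biUnion hpd, ← hU, Finset.sum_sdiff hUsub, ← Finset.sum_mul]
      congr 1
      exact_mod_cast (hTn c hc).symm
    rw [e, mul_add, Finset.mul_sum]
    exact add_le_add hrest (Finset.sum_le_sum fun i _ => hcls i)
  refine hperm.trans ?_
  rw [div_mul_eq_mul_div, div_mul_eq_mul_div, le_div_iff₀ hn0, mul_comm]
  exact hmain
end

section
/- Let 𝓔 = 1 − (1 + log log 2)/log 2 (≈ 0.08607). There exists a constant C > 0 such that for all integers n ≥ 2 and all integers k with 1 ≤ k ≤ n/2, the probability i(n,k) that a uniformly random σ ∈ S_n fixes some set of size k (i.e., there exists S ⊆ {1,…,n} with |S| = k and σ(S) = S) satisfies i(n,k) ≤ C · k^{−𝓔}. -/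
open Finset

namespace FixedSet

variable {α β : Type*} [Fintype α] [DecidableEq α] [Fintype β] [DecidableEq β]

/-- multiplicative weight of a permutation, point by point -/
noncomputable def wt (u : ℕ → ℝ) (σ : Equiv.Perm α) : ℝ :=
  ∏ x, u (Function.minimalPeriod (⇑σ) x)

/-- total weight -/
noncomputable def tot (u : ℕ → ℝ) (m : ℕ) : ℝ :=
  ∑ σ : Equiv.Perm (Fin m), wt u σ

/-- number of full cycles -/
noncomputable def cyc (m : ℕ) : ℕ :=
  (univ.filter fun σ : Equiv.Perm (Fin m) => ∀ x, Function.minimalPeriod (⇑σ) x = m).card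

lemma mp_semiconj {A B : Type*} (f : A → A) (g : B → B) (i : A → B) (hi : Function.Injective i)
    (h : ∀ x, i (f x) = g (i x)) (x : A) :
    Function.minimalPeriod g (i x) = Function.minimalPeriod f x := by
  rw [Function.minimalPeriod_eq_minimalPeriod_iff]
  intro n
  have : Function.Semiconj i f g := h
  have h2 := (this.iterate_right n) x
  simp only [Function.IsPeriodicPt, Function.IsFixedPt]
  rw [← h2]
  exact hi.eq_iff

lemma tot_eq (u : ℕ → ℝ) : ∑ σ : Equiv.Perm α, wt u σ = tot u (Fintype.card α) := by
  let e := Fintype.equivFin α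
  unfold tot
  refine Fintype.sum_equiv e.permCongr _ _ ?_
  intro σ
  unfold wt
  refine Fintype.prod_equiv e _ _ ?_
  intro x
  rw [mp_semiconj (⇑σ) _ e e.injective]
  intro x; simp

lemma cyc_eq : (univ.filter fun σ : Equiv.Perm α =>
    ∀ x, Function.minimalPeriod (⇑σ) x = Fintype.card α).card = cyc (Fintype.card α) := by
  let e := Fintype.equivFin α
  unfold cyc
  refine Finset.card_equiv e.permCongr ?_
  intro σ
  simp only [mem_filter, mem_univ, true_and]
  rw [← e.forall_congr_right]
  refine forall_congr' fun x => ?_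
  rw [mp_semiconj (⇑σ) _ e e.injective]
  intro x; simp

lemma split (p : α → Prop) [DecidablePred p] [Fintype {x // p x}] (g : Equiv.Perm α → ℝ) :
    ∑ σ ∈ univ.filter (fun σ : Equiv.Perm α => ∀ x, p (σ x) ↔ p x), g σ =
    ∑ σ₁ : Equiv.Perm {x // p x}, ∑ σ₂ : Equiv.Perm {x // ¬ p x}, g (σ₁.subtypeCongr σ₂) := by
  rw [← Fintype.sum_prod_type']
  symm
  refine Finset.sum_bij (fun q _ => Equiv.Perm.subtypeCongr q.1 q.2) ?_ ?_ ?_ ?_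
  · rintro ⟨a, b⟩ -
    simp only [mem_filter, mem_univ, true_and]
    intro x
    by_cases hx : p x
    · rw [Equiv.Perm.subtypeCongr.left_apply _ _ hx]
      simp [hx, (a ⟨x, hx⟩).2]
    · rw [Equiv.Perm.subtypeCongr.right_apply _ _ hx]
      simp [hx, (b ⟨x, hx⟩).2]
  · rintro a - b - h
    exact Equiv.Perm.subtypeCongrHom_injective p h
  · intro σ hσ
    simp only [mem_filter, mem_univ, true_and] at hσ
    refine ⟨(σ.subtypePerm hσ, σ.subtypePerm (fun x => not_congr (hσ x))), mem_univ _, ?_⟩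
    ext x
    by_cases hx : p x
    · rw [Equiv.Perm.subtypeCongr.left_apply _ _ hx]; simp
    · rw [Equiv.Perm.subtypeCongr.right_apply _ _ hx]; simp
  · intros; rfl

lemma mp_left (p : α → Prop) [DecidablePred p] (a : Equiv.Perm {x // p x}) (b : Equiv.Perm {x // ¬ p x}) (x) :
    Function.minimalPeriod (⇑(a.subtypeCongr b)) (x : {x // p x}) =
      Function.minimalPeriod (⇑a) x :=
  mp_semiconj _ _ Subtype.val Subtype.val_injective (fun x => by simp) x

lemma mp_right (p : α → Prop) [DecidablePred p] (a : Equiv.Perm {x // p x}) (b : Equiv.Perm {x // ¬ p x}) (x) :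
    Function.minimalPeriod (⇑(a.subtypeCongr b)) (x : {x // ¬ p x}) =
      Function.minimalPeriod (⇑b) x :=
  mp_semiconj _ _ Subtype.val Subtype.val_injective (fun x => by simp) x

lemma wt_split (u : ℕ → ℝ) (p : α → Prop) [DecidablePred p] [inst : Fintype {x // p x}]
    (a : Equiv.Perm {x // p x}) (b : Equiv.Perm {x // ¬ p x}) :
    wt u (a.subtypeCongr b) = wt u a * wt u b := by
  have hi : inst = Subtype.fintype p := Subsingleton.elim _ _
  subst hi
  unfold wt
  rw [← Fintype.prod_subtype_mul_prod_subtype p]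
  congr 1
  · exact Fintype.prod_congr _ _ fun x => by rw [mp_left]
  · exact Fintype.prod_congr _ _ fun x => by rw [mp_right]

lemma fix_sum (u : ℕ → ℝ) (S : Finset α) :
    ∑ σ ∈ univ.filter (fun σ : Equiv.Perm α => ∀ x, σ x ∈ S ↔ x ∈ S), wt u σ =
      tot u S.card * tot u (Fintype.card α - S.card) := by
  rw [split (fun x => x ∈ S)]
  simp_rw [wt_split, ← Finset.mul_sum, ← Finset.sum_mul]
  rw [tot_eq, tot_eq]
  congr 2
  · simp
  · rw [Fintype.card_subtype_compl]; simp

/-- `S` is (the support of) a cycle of `σ` -/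
def IsCyc (σ : Equiv.Perm α) (S : Finset α) : Prop :=
  (∀ x, σ x ∈ S ↔ x ∈ S) ∧ ∀ x ∈ S, Function.minimalPeriod (⇑σ) x = S.card

noncomputable instance (σ : Equiv.Perm α) (S : Finset α) : Decidable (IsCyc σ S) :=
  inferInstanceAs (Decidable (_ ∧ _))

lemma cyc_sum (u : ℕ → ℝ) (S : Finset α) :
    ∑ σ ∈ univ.filter (fun σ : Equiv.Perm α => IsCyc σ S), wt u σ =
      cyc S.card * u S.card ^ S.card * tot u (Fintype.card α - S.card) := by
  have h1 : ∑ σ ∈ univ.filter (fun σ : Equiv.Perm α => IsCyc σ S), wt u σ =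
    ∑ σ ∈ univ.filter (fun σ : Equiv.Perm α => ∀ x, σ x ∈ S ↔ x ∈ S),
      if (∀ x ∈ S, Function.minimalPeriod (⇑σ) x = S.card) then wt u σ else 0 := by
    rw [← Finset.sum_filter, Finset.filter_filter]; rfl
  rw [h1, split (fun x => x ∈ S)]
  have h2 : ∀ (a : Equiv.Perm {x // x ∈ S}) (b : Equiv.Perm {x // ¬ x ∈ S}),
      (if (∀ x ∈ S, Function.minimalPeriod (⇑(a.subtypeCongr b)) x = S.card)
        then wt u (a.subtypeCongr b) else 0) =
      (if (∀ x, Function.minimalPeriod (⇑a) x = Fintype.card {x // x ∈ S})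
        then u S.card ^ S.card else 0) * wt u b := by
    intro a b
    have h3 : (∀ x ∈ S, Function.minimalPeriod (⇑(a.subtypeCongr b)) x = S.card) ↔
        (∀ x, Function.minimalPeriod (⇑a) x = Fintype.card {x // x ∈ S}) := by
      constructor
      · intro h x
        rw [← mp_left _ a b, h x x.2]; simp
      · intro h x hx
        rw [mp_left _ a b ⟨x, hx⟩, h]; simp
    simp only [h3]
    split_ifs with h4
    · rw [wt_split]
      congr 1
      unfold wt
      simp [h4]
    · simp
  simp_rw [h2, ← Finset.mul_sum, ← Finset.sum_mul]
  rw [tot_eq, ← Finset.sum_filter, Finset.sum_const, cyc_eq, Fintype.card_subtype_compl]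
  simp

lemma existsUnique_cyc (σ : Equiv.Perm α) (x : α) :
    (univ.filter fun S : Finset α => IsCyc σ S ∧ x ∈ S).card = 1 := by
  set O : α → Finset α := fun x =>
    (range (Function.minimalPeriod (⇑σ) x)).image (fun i => (⇑σ)^[i] x) with hO
  have hpos : ∀ x, 0 < Function.minimalPeriod (⇑σ) x := by
    intro x
    apply Function.minimalPeriod_pos_of_mem_periodicPts
    exact σ.injective.mem_periodicPts x
  have hcard : ∀ x, (O x).card = Function.minimalPeriod (⇑σ) x := by
    intro x
    rw [hO, Finset.card_image_of_injOn, card_range]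
    intro i hi j hj hij
    simp only [coe_range, Set.mem_Iio] at hi hj
    exact (Function.iterate_injOn_Iio_minimalPeriod) hi hj hij
  have hmem : ∀ x i, (⇑σ)^[i] x ∈ O x := by
    intro x i
    rw [hO, mem_image]
    exact ⟨i % Function.minimalPeriod (⇑σ) x, by simpa using Nat.mod_lt _ (hpos x),
      Function.iterate_mod_minimalPeriod_eq⟩
  rw [Finset.card_eq_one]
  refine ⟨O x, ?_⟩
  ext S
  simp only [mem_filter, mem_univ, true_and, mem_singleton]
  have hinv : ∀ x y, y ∈ O x → σ y ∈ O x := by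
    intro x y hy
    obtain ⟨i, -, rfl⟩ := mem_image.1 hy
    have := hmem x (i+1)
    rwa [Function.iterate_succ_apply'] at this
  constructor
  · rintro ⟨⟨h1, h2⟩, hx⟩
    symm
    apply Finset.eq_of_subset_of_card_le
    · intro y hy
      obtain ⟨i, -, rfl⟩ := mem_image.1 hy
      induction i with
      | zero => simpa
      | succ i ih =>
        simp only [Function.iterate_succ_apply'] at *
        rw [h1]; exact ih (hmem _ _)
    · rw [hcard, h2 x hx]
  · rintro rfl
    refine ⟨⟨?_, ?_⟩, hmem x 0⟩
    · intro y
      refine ⟨?_, hinv x y⟩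
      intro hy
      have : (O x).image σ = O x := by
        apply Finset.eq_of_subset_of_card_le
        · intro z hz
          obtain ⟨w, hw, rfl⟩ := mem_image.1 hz
          exact hinv x w hw
        · rw [Finset.card_image_of_injective _ σ.injective]
      rw [← this, mem_image] at hy
      obtain ⟨w, hw, h⟩ := hy
      rwa [← σ.injective h]
    · intro y hy
      obtain ⟨i, -, rfl⟩ := mem_image.1 hy
      rw [hcard]
      exact Function.minimalPeriod_apply_iterate (σ.injective.mem_periodicPts x) i

lemma sum_cyc_card (σ : Equiv.Perm α) :
    ∑ S ∈ univ.filter (fun S : Finset α => IsCyc σ S), (S.card : ℝ) = Fintype.card α := by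
  have h : ∀ x : α, ∑ S ∈ univ.filter (fun S : Finset α => IsCyc σ S),
      (if x ∈ S then (1:ℝ) else 0) = 1 := by
    intro x
    rw [← Finset.sum_filter, Finset.filter_filter, Finset.sum_const, existsUnique_cyc]; simp
  calc _ = ∑ S ∈ univ.filter (fun S : Finset α => IsCyc σ S),
      ∑ x, (if x ∈ S then (1:ℝ) else 0) := by simp
    _ = _ := by rw [Finset.sum_comm]; simp [h]

lemma rec_raw (u : ℕ → ℝ) (m : ℕ) :
    (m : ℝ) * tot u m = ∑ j ∈ range (m+1),
      (m.choose j : ℝ) * (j * (cyc j * u j ^ j * tot u (m - j))) := by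
  classical
  have h1 : (m : ℝ) * tot u m = ∑ σ : Equiv.Perm (Fin m), ∑ S : Finset (Fin m),
      if IsCyc σ S then (S.card : ℝ) * wt u σ else 0 := by
    unfold tot
    rw [Finset.mul_sum]
    refine Finset.sum_congr rfl fun σ _ => ?_
    rw [← Finset.sum_filter, ← Finset.sum_mul, sum_cyc_card]; simp
  rw [h1, Finset.sum_comm]
  have h2 : ∀ S : Finset (Fin m), (∑ σ : Equiv.Perm (Fin m),
      if IsCyc σ S then (S.card : ℝ) * wt u σ else 0) =
      (fun j : ℕ => (j : ℝ) * (cyc j * u j ^ j * tot u (m - j))) S.card := by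
    intro S
    rw [← Finset.sum_filter, ← Finset.mul_sum, cyc_sum]; simp
  simp_rw [h2]
  have := Finset.sum_powerset_apply_card
    (fun j : ℕ => (j : ℝ) * (cyc j * u j ^ j * tot u (m - j))) (x := (univ : Finset (Fin m)))
  simpa using this

/-- normalised -/
noncomputable def av (u : ℕ → ℝ) (m : ℕ) : ℝ := tot u m / m.factorial

lemma rec_av (u : ℕ → ℝ) (m : ℕ) :
    (m : ℝ) * av u m = ∑ j ∈ range (m+1),
      ((j : ℝ) * cyc j / j.factorial) * u j ^ j * av u (m - j) := by
  unfold av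
  rw [← mul_div_assoc, rec_raw, Finset.sum_div]
  refine Finset.sum_congr rfl fun j hj => ?_
  have hj' : j ≤ m := by simpa [Nat.lt_succ_iff] using hj
  rw [Nat.cast_choose ℝ hj']
  have := Nat.factorial_ne_zero j
  have := Nat.factorial_ne_zero m
  have := Nat.factorial_ne_zero (m - j)
  field_simp

lemma av_one (m : ℕ) : av (fun _ => 1) m = 1 := by
  unfold av tot wt
  have := Nat.factorial_ne_zero m
  simp [Fintype.card_perm, this]

lemma cyc_val (j : ℕ) (hj : 1 ≤ j) : (j : ℝ) * cyc j / j.factorial = 1 := by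
  obtain ⟨m, rfl⟩ : ∃ m, j = m + 1 := ⟨j - 1, by omega⟩
  have h1 := rec_av (fun _ => 1) m
  have h2 := rec_av (fun _ => 1) (m+1)
  simp only [av_one, one_pow, mul_one] at h1 h2
  rw [Finset.sum_range_succ, ← h1] at h2
  push_cast at h2 ⊢
  linarith

lemma rec_av' (u : ℕ → ℝ) (m : ℕ) :
    (m : ℝ) * av u m = ∑ i ∈ range m, u (m - i) ^ (m - i) * av u i := by
  rw [rec_av, Finset.sum_range_succ', ← Finset.sum_range_reflect]
  simp only [Nat.cast_zero, zero_mul, zero_div, add_zero]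
  refine Finset.sum_congr rfl fun j hj => ?_
  have hj' : j < m := by simpa using hj
  have e : m - 1 - j + 1 = m - j := by omega
  rw [e, cyc_val _ (by omega), one_mul]
  congr 2
  omega

lemma av_zero (u : ℕ → ℝ) : av u 0 = 1 := by
  unfold av tot wt
  simp

end FixedSet

namespace FixedSet

section
variable (a : ℕ → ℝ) (z : ℝ) (k : ℕ) 

lemma seq_S (h : ∀ m : ℕ, (m : ℝ) * a m = ∑ i ∈ range m, (if m - i ≤ k then z else 1) * a i) (m : ℕ) :
    (m : ℝ) * a m = ∑ i ∈ range m, a i + (z - 1) * (∑ i ∈ range m, a i - ∑ i ∈ range (m - k), a i) := by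
  rw [h]
  have h1 : ∑ i ∈ range (m - k), a i = ∑ i ∈ range m, if i < m - k then a i else 0 := by
    rw [← Finset.sum_filter]
    congr 1
    ext i; simp; omega
  rw [h1, ← Finset.sum_sub_distrib, Finset.mul_sum, ← Finset.sum_add_distrib]
  refine Finset.sum_congr rfl fun i hi => ?_
  have : i < m := by simpa using hi
  by_cases hc : m - i ≤ k
  · rw [if_pos hc, if_neg (by omega)]; ring
  · rw [if_neg hc, if_pos (by omega)]; ring

variable (h : ∀ m : ℕ, (m : ℝ) * a m =
  ∑ i ∈ range m, a i + (z - 1) * (∑ i ∈ range m, a i - ∑ i ∈ range (m - k), a i))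
  (hpos : ∀ m, 0 ≤ a m) (h0 : a 0 = 1)
include h hpos

lemma S_mono {i j : ℕ} (hij : i ≤ j) : ∑ i ∈ range i, a i ≤ ∑ i ∈ range j, a i :=
  Finset.sum_le_sum_of_subset_of_nonneg (by simpa using hij) fun i _ _ => hpos i

include h0 in
lemma le_exp (hz : 0 ≤ z) (m : ℕ) (hm : m ≤ k) : a m ≤ Real.exp ((z - 1) * harmonic m) := by
  induction m with
  | zero => simp [h0]
  | succ m ih =>
    have ih := ih (by omega)
    have h1 := h m
    have h2 := h (m+1)
    rw [show m - k = 0 by omega] at h1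
    rw [show m + 1 - k = 0 by omega, Finset.sum_range_succ] at h2
    push_cast at h1 h2
    have hm1 : (0:ℝ) < m + 1 := by positivity
    have h3 : a (m+1) = (1 + (z-1)/(m+1)) * a m := by
      field_simp
      simp only [Finset.sum_range_zero] at h1 h2
      linarith
    rw [h3, harmonic_succ]
    push_cast
    rw [mul_add, Real.exp_add, mul_comm]
    have h4 : 1 + (z-1)/(m+1) ≤ Real.exp ((z - 1) * ((m:ℝ) + 1)⁻¹) := by
      rw [add_comm]; exact Real.add_one_le_exp _
    have h5 : 0 ≤ 1 + (z-1)/((m:ℝ)+1) := by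
      have : 1 + (z-1)/((m:ℝ)+1) = (m + z)/(m+1) := by field_simp; ring
      rw [this]; positivity
    exact mul_le_mul ih h4 h5 (Real.exp_pos _).le

lemma small_z (hz : 0 < z) (hz1 : z ≤ 1) (hk : 1 ≤ k) (m : ℕ) (hm : k ≤ m) : a m ≤ a k / z := by
  have hM : a k ≤ a k / z := by
    rw [le_div_iff₀ hz]; nlinarith [hpos k]
  have hk0 : ∑ i ∈ range k, a i = k * (a k / z) := by
    have := h k
    simp only [Nat.sub_self, Finset.sum_range_zero] at this
    field_simp; linarith
  suffices H : ∀ m, k ≤ m → ∑ i ∈ range m, a i ≤ m * (a k / z) ∧ a m ≤ a k / z from (H m hm).2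
  intro m hm
  induction m, hm using Nat.le_induction with
  | base => exact ⟨hk0.le, hM⟩
  | succ m hm ih =>
    have h1 : ∑ i ∈ range (m+1), a i ≤ ((m+1 : ℕ) : ℝ) * (a k / z) := by
      rw [Finset.sum_range_succ]; push_cast; linarith [ih.1, ih.2]
    refine ⟨h1, ?_⟩
    have h2 := h (m+1)
    have h3 := S_mono a z k h hpos (show m + 1 - k ≤ m + 1 by omega)
    have h4 : ((m+1 : ℕ) : ℝ) * a (m+1) ≤ ((m+1 : ℕ) : ℝ) * (a k / z) := by nlinarith
    exact le_of_mul_le_mul_left h4 (by positivity)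

include h0 in
lemma large_z (hz : 1 ≤ z) (hz1 : z < 2) (hk : 1 ≤ k) (m : ℕ) (hm : k ≤ m) :
    a m ≤ a k / (2 - z) := by
  have hstep1 : ∀ m, k ≤ m → ((m:ℝ)+1) * (a (m+1) - a m) = (z-1) * (a m - a (m-k)) := by
    intro m hm
    have h1 := h m
    have h2 := h (m+1)
    rw [show m + 1 - k = (m - k) + 1 by omega, Finset.sum_range_succ, Finset.sum_range_succ] at h2
    push_cast at h2
    linarith
  have hstep2 : ∀ m, m < k → ((m:ℝ)+1) * (a (m+1) - a m) = (z-1) * a m := by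
    intro m hm
    have h1 := h m
    have h2 := h (m+1)
    rw [show m - k = 0 by omega] at h1
    rw [show m + 1 - k = 0 by omega, Finset.sum_range_succ] at h2
    push_cast at h2
    linarith
  have hmono : ∀ m, ∀ i ≤ m, a i ≤ a m := by
    intro m
    induction m with
    | zero => intro i hi; simp_all
    | succ m ih =>
      have hs : a m ≤ a (m+1) := by
        have : 0 ≤ ((m:ℝ)+1) * (a (m+1) - a m) := by
          by_cases hm : k ≤ m
          · rw [hstep1 m hm]
            exact mul_nonneg (by linarith) (by linarith [ih (m-k) (by omega)])
          · rw [hstep2 m (by omega)]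
            exact mul_nonneg (by linarith) (hpos m)
        have := nonneg_of_mul_nonneg_right this (by positivity)
        linarith
      intro i hi
      rcases Nat.lt_or_ge i (m+1) with h' | h'
      · exact (ih i (by omega)).trans hs
      · rw [show i = m+1 by omega]
  have hinv : ∀ m, k ≤ m →
      a m ≤ a k + (z-1)/(k+1) * (∑ i ∈ range m, a i - ∑ i ∈ range (m - k), a i) := by
    intro m hm
    induction m, hm using Nat.le_induction with
    | base =>
      simp only [Nat.sub_self, Finset.sum_range_zero, sub_zero]
      have : 0 ≤ ∑ i ∈ range k, a i := Finset.sum_nonneg fun i _ => hpos i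
      have : 0 ≤ (z-1)/(k+1) * ∑ i ∈ range k, a i :=
        mul_nonneg (div_nonneg (by linarith) (by positivity)) this
      linarith
    | succ m hm ih =>
      rw [show m + 1 - k = (m - k) + 1 by omega, Finset.sum_range_succ, Finset.sum_range_succ]
      have hs : a (m+1) - a m ≤ (z-1)/(k+1) * (a m - a (m-k)) := by
        have e : a (m+1) - a m = (z-1)/(m+1) * (a m - a (m-k)) := by
          have := hstep1 m hm
          field_simp; linarith
        rw [e]
        apply mul_le_mul_of_nonneg_right
        · apply div_le_div_of_nonneg_left (by linarith) (by positivity)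
          have : (k:ℝ) ≤ m := by exact_mod_cast hm
          linarith
        · linarith [hmono m (m-k) (by omega)]
      linarith
  have hw : ∑ i ∈ range m, a i - ∑ i ∈ range (m - k), a i ≤ k * a m := by
    have e : ∑ i ∈ range m, a i - ∑ i ∈ range (m - k), a i = ∑ i ∈ Ico (m-k) m, a i := by
      rw [Finset.sum_Ico_eq_sub _ (by omega)]
    rw [e]
    have := Finset.sum_le_card_nsmul (Ico (m-k) m) a (a m) (by
      intro i hi; exact hmono m i (by simp at hi; omega))
    simpa [Nat.sub_sub_self hm] using this
  have h1 := hinv m hm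
  have h2 : (z-1)/(k+1) * (∑ i ∈ range m, a i - ∑ i ∈ range (m - k), a i) ≤ (z-1) * a m := by
    calc _ ≤ (z-1)/(k+1) * (k * a m) :=
          mul_le_mul_of_nonneg_left hw (div_nonneg (by linarith) (by positivity))
      _ = (z-1) * a m * (k/(k+1)) := by ring
      _ ≤ (z-1) * a m * 1 := by
          apply mul_le_mul_of_nonneg_left
          · rw [div_le_one (by positivity)]; linarith
          · exact mul_nonneg (by linarith) (hpos m)
      _ = _ := by ring
  rw [le_div_iff₀ (by linarith)]
  linarith

include h0 in
lemma small_z' (hz : 0 < z) (hz1 : z ≤ 1) (hk : 1 ≤ k) (m : ℕ) (hm : k ≤ m) :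
    a m ≤ 1 / z * (k:ℝ) ^ (z-1) := by
  have h1 := small_z a z k h hpos hz hz1 hk m hm
  have h2 := le_exp a z k h hpos h0 hz.le k le_rfl
  have h3 : Real.log k ≤ harmonic k := by
    refine le_trans (Real.log_le_log (by positivity) ?_) (log_add_one_le_harmonic k)
    push_cast; linarith
  have hk' : (0:ℝ) < k := by positivity
  have h4 : a k ≤ (k:ℝ) ^ (z-1) := by
    refine h2.trans ?_
    rw [Real.rpow_def_of_pos hk', Real.exp_le_exp]
    nlinarith
  calc a m ≤ a k / z := h1
    _ ≤ (k:ℝ)^(z-1) / z := by gcongr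
    _ = _ := by ring

include h0 in
lemma large_z' (hz : 1 ≤ z) (hz1 : z < 2) (hk : 1 ≤ k) (m : ℕ) (hm : k ≤ m) :
    a m ≤ Real.exp (z-1) / (2 - z) * (k:ℝ) ^ (z-1) := by
  have h1 := large_z a z k h hpos h0 hz hz1 hk m hm
  have h2 := le_exp a z k h hpos h0 (by linarith) k le_rfl
  have h3 := harmonic_le_one_add_log k
  have hk' : (0:ℝ) < k := by positivity
  have h4 : a k ≤ Real.exp (z-1) * (k:ℝ) ^ (z-1) := by
    refine h2.trans ?_
    rw [Real.rpow_def_of_pos hk', ← Real.exp_add, Real.exp_le_exp]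
    nlinarith
  have : 0 < 2 - z := by linarith
  calc a m ≤ a k / (2-z) := h1
    _ ≤ (Real.exp (z-1) * (k:ℝ) ^ (z-1)) / (2-z) := by gcongr
    _ = _ := by ring

end
end FixedSet
namespace FixedSet

/-- additive point weights: each cycle of length at most `k` gets total weight one -/
noncomputable def vv (k j : ℕ) : ℝ := if j ≤ k then 1 / (j : ℝ) else 0

/-- number of cycles of length at most `k` -/
noncomputable def om (k : ℕ) {n : ℕ} (σ : Equiv.Perm (Fin n)) : ℝ :=
  ∑ x, vv k (Function.minimalPeriod (⇑σ) x)

/-- point weights -/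
noncomputable def uu (z : ℝ) (k j : ℕ) : ℝ := z ^ (vv k j)

lemma wt_uu (z : ℝ) (hz : 0 < z) (k : ℕ) {n : ℕ} (σ : Equiv.Perm (Fin n)) :
    wt (uu z k) σ = z ^ (om k σ) := by
  unfold wt uu om
  rw [Real.rpow_sum_of_pos hz]

lemma uu_pow (z : ℝ) (hz : 0 < z) (k j : ℕ) (hj : 1 ≤ j) :
    uu z k j ^ j = if j ≤ k then z else 1 := by
  unfold uu vv
  have : (j : ℝ) ≠ 0 := by positivity
  split_ifs
  · rw [← Real.rpow_mul_natCast hz.le]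
    field_simp; simp
  · simp

lemma av_nonneg (z : ℝ) (hz : 0 < z) (k m : ℕ) : 0 ≤ av (uu z k) m := by
  unfold av tot
  refine div_nonneg (Finset.sum_nonneg fun σ _ => ?_) (by positivity)
  rw [wt_uu z hz]
  positivity

lemma av_rec (z : ℝ) (hz : 0 < z) (k m : ℕ) :
    (m : ℝ) * av (uu z k) m = ∑ i ∈ range m, av (uu z k) i +
      (z - 1) * (∑ i ∈ range m, av (uu z k) i - ∑ i ∈ range (m - k), av (uu z k) i) := by
  refine seq_S _ z k (fun m => ?_) m
  rw [rec_av']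
  refine Finset.sum_congr rfl fun i hi => ?_
  have : i < m := by simpa using hi
  rw [uu_pow z hz _ _ (by omega)]

lemma fix_iff {n : ℕ} (σ : Equiv.Perm (Fin n)) (S : Finset (Fin n)) (h : S.image ⇑σ = S) :
    ∀ x, σ x ∈ S ↔ x ∈ S := by
  intro x
  conv_lhs => rw [← h]
  simp

lemma prob_le (n k : ℕ) (hkn : k ≤ n) (z₁ z₂ L : ℝ) (h1 : 1 ≤ z₁) (h2 : 0 < z₂) (h2' : z₂ ≤ 1) :
    permP n (fun σ => ∃ S : Finset (Fin n), S.card = k ∧ S.image ⇑σ = S) ≤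
      z₁ ^ (-L) * av (uu z₁ k) n + z₂ ^ (-L) * (av (uu z₂ k) k * av (uu z₂ k) (n - k)) := by
  classical
  have hz1 : 0 < z₁ := by linarith
  have hf : (0:ℝ) < n.factorial := by positivity
  unfold permP
  rw [div_le_iff₀ hf]
  have hc : (Nat.card {σ : Equiv.Perm (Fin n) //
      ∃ S : Finset (Fin n), S.card = k ∧ S.image ⇑σ = S} : ℝ) =
      ∑ σ : Equiv.Perm (Fin n),
        if (∃ S : Finset (Fin n), S.card = k ∧ S.image ⇑σ = S) then (1:ℝ) else 0 := by
    rw [Nat.card_eq_fintype_card, Fintype.card_subtype]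
    simp
  rw [hc]
  have hpt : ∀ σ : Equiv.Perm (Fin n),
      (if (∃ S : Finset (Fin n), S.card = k ∧ S.image ⇑σ = S) then (1:ℝ) else 0) ≤
      z₁ ^ (-L) * wt (uu z₁ k) σ + ∑ S ∈ powersetCard k (univ : Finset (Fin n)),
        if (∀ x, σ x ∈ S ↔ x ∈ S) then z₂ ^ (-L) * wt (uu z₂ k) σ else 0 := by
    intro σ
    rw [wt_uu _ hz1, wt_uu _ h2, ← Real.rpow_add hz1, ← Real.rpow_add h2]
    have hA : 0 ≤ z₁ ^ (-L + om k σ) := by positivity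
    have hB0 : ∀ S ∈ powersetCard k (univ : Finset (Fin n)),
        0 ≤ (if (∀ x, σ x ∈ S ↔ x ∈ S) then z₂ ^ (-L + om k σ) else 0) := by
      intro S _
      split_ifs <;> positivity
    have hB := Finset.sum_nonneg hB0
    split_ifs with hE
    · obtain ⟨S, hS, hσ⟩ := hE
      rcases le_total L (om k σ) with hL | hL
      · have := Real.one_le_rpow h1 (show 0 ≤ -L + om k σ by linarith)
        linarith
      · have h3 := Real.one_le_rpow_of_pos_of_le_one_of_nonpos h2 h2'
          (show -L + om k σ ≤ 0 by linarith)
        have h4 := Finset.single_le_sum hB0 (show S ∈ powersetCard k univ by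
          simp [mem_powersetCard, hS])
        rw [if_pos (fix_iff σ S hσ)] at h4
        linarith
    · linarith
  refine (Finset.sum_le_sum fun σ _ => hpt σ).trans (le_of_eq ?_)
  rw [Finset.sum_add_distrib, ← Finset.mul_sum, Finset.sum_comm]
  have hS : ∀ S ∈ powersetCard k (univ : Finset (Fin n)),
      (∑ σ : Equiv.Perm (Fin n),
        if (∀ x, σ x ∈ S ↔ x ∈ S) then z₂ ^ (-L) * wt (uu z₂ k) σ else 0) =
      z₂ ^ (-L) * (tot (uu z₂ k) k * tot (uu z₂ k) (n - k)) := by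
    intro S hS
    have hk : S.card = k := (mem_powersetCard.1 hS).2
    have := fix_sum (uu z₂ k) S
    rw [hk, Fintype.card_fin] at this
    rw [← Finset.sum_filter, ← Finset.mul_sum, ← this]
    congr
  rw [Finset.sum_congr rfl hS, Finset.sum_const, card_powersetCard]
  simp only [card_univ, Fintype.card_fin, nsmul_eq_mul]
  rw [Nat.cast_choose ℝ hkn]
  unfold av
  have e : ∑ i : Equiv.Perm (Fin n), wt (uu z₁ k) i = tot (uu z₁ k) n := rfl
  rw [e]
  have := Nat.factorial_ne_zero k
  have := Nat.factorial_ne_zero (n - k)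
  field_simp

end FixedSet

open FixedSet in
/-- **Fixed sets of size `k`.** With `𝓔 = 1 - (1 + log log 2)/log 2`, there is a
constant `C > 0` such that for all `n ≥ 2` and `1 ≤ k ≤ n/2`, the probability
that a random `σ ∈ Sₙ` fixes some set of size `k` is at most `C k^{-𝓔}`. -/
theorem fixed_set_probability_bound :
    ∃ C : ℝ, 0 < C ∧ ∀ n k : ℕ, 2 ≤ n → 1 ≤ k → (k : ℝ) ≤ (n : ℝ) / 2 →
      permP n (fun σ => ∃ S : Finset (Fin n), S.card = k ∧ S.image ⇑σ = S)
        ≤ C * (k : ℝ) ^ (-(1 - (1 + Real.log (Real.log 2)) / Real.log 2)) := by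
  set ℓ := Real.log 2 with hℓ
  have hl1 : 0.6931471803 < ℓ := Real.log_two_gt_d9
  have hl2 : ℓ < 0.6931471808 := Real.log_two_lt_d9
  have hl0 : 0 < ℓ := by linarith
  obtain ⟨z₁, hz₁⟩ : ∃ z, z = 1 / ℓ := ⟨_, rfl⟩
  obtain ⟨z₂, hz₂⟩ : ∃ z, z = 1 / (2 * ℓ) := ⟨_, rfl⟩
  have h1 : 1 ≤ z₁ := by rw [hz₁, le_div_iff₀ hl0]; linarith
  have h1' : z₁ < 2 := by rw [hz₁, div_lt_iff₀ hl0]; linarith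
  have h2 : 0 < z₂ := by rw [hz₂]; positivity
  have h2' : z₂ ≤ 1 := by rw [hz₂, div_le_iff₀ (by positivity)]; linarith
  have hz1 : 0 < z₁ := by linarith
  have h2z : 0 < 2 - z₁ := by linarith
  refine ⟨Real.exp (z₁-1) / (2 - z₁) + 1 / z₂ * (1 / z₂), by positivity, ?_⟩
  intro n k hn hk hkn
  have hk0 : (0:ℝ) < k := by positivity
  have hkn' : 2 * k ≤ n := by
    have : (2 * k : ℝ) ≤ n := by linarith
    exact_mod_cast this
  have hb1 := large_z' _ z₁ k (av_rec z₁ hz1 k) (av_nonneg z₁ hz1 k) (av_zero _) h1 h1' hk n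
    (by omega)
  have hb2 := small_z' _ z₂ k (av_rec z₂ h2 k) (av_nonneg z₂ h2 k) (av_zero _) h2 h2' hk k le_rfl
  have hb3 := small_z' _ z₂ k (av_rec z₂ h2 k) (av_nonneg z₂ h2 k) (av_zero _) h2 h2' hk (n - k)
    (by omega)
  refine (prob_le n k (by omega) z₁ z₂ (Real.log k / ℓ) h1 h2 h2').trans ?_
  set E := -(1 - (1 + Real.log ℓ) / ℓ) with hE
  have e1 : z₁ ^ (-(Real.log k / ℓ)) * (k:ℝ) ^ (z₁ - 1) = (k:ℝ) ^ E := by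
    rw [Real.rpow_def_of_pos hz1, Real.rpow_def_of_pos hk0, Real.rpow_def_of_pos hk0,
      ← Real.exp_add]
    congr 1
    rw [hE, hz₁, Real.log_div one_ne_zero hl0.ne', Real.log_one]
    field_simp
    ring
  have e2 : z₂ ^ (-(Real.log k / ℓ)) * ((k:ℝ) ^ (z₂ - 1) * (k:ℝ) ^ (z₂ - 1)) = (k:ℝ) ^ E := by
    rw [Real.rpow_def_of_pos h2, Real.rpow_def_of_pos hk0, Real.rpow_def_of_pos hk0,
      ← Real.exp_add, ← Real.exp_add]
    congr 1
    rw [hE, hz₂, Real.log_div one_ne_zero (by positivity), Real.log_one,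
      Real.log_mul (by norm_num) hl0.ne', ← hℓ]
    field_simp
    ring
  have hmul : av (uu z₂ k) k * av (uu z₂ k) (n - k) ≤
      (1 / z₂ * (k:ℝ) ^ (z₂ - 1)) * (1 / z₂ * (k:ℝ) ^ (z₂ - 1)) :=
    mul_le_mul hb2 hb3 (av_nonneg z₂ h2 k _) (by positivity)
  calc _ ≤ z₁ ^ (-(Real.log k / ℓ)) * (Real.exp (z₁-1) / (2 - z₁) * (k:ℝ) ^ (z₁-1)) +
        z₂ ^ (-(Real.log k / ℓ)) *
          ((1 / z₂ * (k:ℝ) ^ (z₂ - 1)) * (1 / z₂ * (k:ℝ) ^ (z₂ - 1))) := by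
        gcongr
    _ = Real.exp (z₁-1) / (2 - z₁) * (z₁ ^ (-(Real.log k / ℓ)) * (k:ℝ) ^ (z₁ - 1)) +
        1 / z₂ * (1 / z₂) *
          (z₂ ^ (-(Real.log k / ℓ)) * ((k:ℝ) ^ (z₂ - 1) * (k:ℝ) ^ (z₂ - 1))) := by ring
    _ = _ := by rw [e1, e2]; ring
end
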